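/- arXiv:1503.03323 — 6 statements merged into one kernel-verified Lean document; each statement's English description precedes it below -/
import Mathlib

section
/- Fix integers u, s ≥ 1 and m ≥ 1, and reals K > 0 and ρ ∈ (0,1). There exists M* > 0, depending only on u, s, m, K, ρ, with the following property. Let D ⊆ ℝ^u × ℝ^s be a convex bounded neighborhood of 0 and f : D → ℝ^u × ℝ^s a C^{m+1} map with f(0) = 0 all of whose derivatives of order ≤ m+1 are bounded in norm by some C ≤ K on D. Let P, Q : ℝ^u → ℝ^s be polynomial maps of degree ≤ m with P(0) = Q(0) = 0 whose symmetric multilinear coefficients are bounded in norm by C, and suppose the degree-m Taylor polynomial T at 0 of the map x ↦ f(x, P(x)) takes values in the graph of Q, i.e. π_y T(x) = Q(π_x T(x)) for all x ∈ ℝ^u. Suppose there are ξ > 0, B ≥ 0, μ ≥ 0 with 1/ξ ≤ K, B ≤ K and μ/ξ^{m+1} < ρ such that m(∂f_x/∂x(0) + ∂f_x/∂y(0)∘DP(0)) ≥ ξ, ‖∂f_x/∂y(0)‖ ≤ B, and ‖∂f_y/∂y(0) − DQ(0)∘∂f_x/∂y(0)‖ ≤ μ. Then for every M > M* there exists δ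 > 0 such that for all (x,y) ∈ D with ‖(x,y)‖ ≤ δ and ‖y − P(x)‖ ≤ M‖x‖^{m+1}, the image satisfies ‖π_y f(x,y) − Q(π_x f(x,y))‖ ≤ M‖π_x f(x,y)‖^{m+1} (i.e. f maps J_u(0,P,M) ∩ B̄(0,δ) ∩ D into J_u(0,Q,M)). -/
noncomputable section

open Metric Set

/-- `ℝ^n` with the Euclidean norm. -/
abbrev Evec (n : ℕ) : Type := EuclideanSpace ℝ (Fin n)

/-- `ℝ^u × ℝ^s` with the Euclidean (ℓ²) product norm. -/
abbrev EF (u s : ℕ) : Type := WithLp 2 (Evec u × Evec s)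

/-- Projection `π_x` onto the first factor. -/
def projX (u s : ℕ) : EF u s →L[ℝ] Evec u :=
  (ContinuousLinearMap.fst ℝ (Evec u) (Evec s)).comp
    (WithLp.prodContinuousLinearEquiv 2 ℝ (Evec u) (Evec s)).toContinuousLinearMap

/-- Projection `π_y` onto the second factor. -/
def projY (u s : ℕ) : EF u s →L[ℝ] Evec s :=
  (ContinuousLinearMap.snd ℝ (Evec u) (Evec s)).comp
    (WithLp.prodContinuousLinearEquiv 2 ℝ (Evec u) (Evec s)).toContinuousLinearMap

/-- Inclusion `v ↦ (v, 0)` of the first factor. -/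
def inX (u s : ℕ) : Evec u →L[ℝ] EF u s :=
  ((WithLp.prodContinuousLinearEquiv 2 ℝ (Evec u) (Evec s)).symm.toContinuousLinearMap).comp
    (ContinuousLinearMap.inl ℝ (Evec u) (Evec s))

/-- Inclusion `w ↦ (0, w)` of the second factor. -/
def inY (u s : ℕ) : Evec s →L[ℝ] EF u s :=
  ((WithLp.prodContinuousLinearEquiv 2 ℝ (Evec u) (Evec s)).symm.toContinuousLinearMap).comp
    (ContinuousLinearMap.inr ℝ (Evec u) (Evec s))

/-- `m(A)`: the largest `t ≥ 0` such that `‖A v‖ ≥ t * ‖v‖` for all `v`. -/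
def minNorm {E F : Type*} [NormedAddCommGroup E] [NormedSpace ℝ E]
    [NormedAddCommGroup F] [NormedSpace ℝ F] (A : E →L[ℝ] F) : ℝ :=
  sSup {t : ℝ | 0 ≤ t ∧ ∀ v, t * ‖v‖ ≤ ‖A v‖}


/-- The degree-`m` Taylor polynomial at `0` of a map `g`,
`T(x) = Σ_{k=0}^m (1/k!) D^k g(0)(x,…,x)`. -/
def taylorPoly {E F : Type*} [NormedAddCommGroup E] [NormedSpace ℝ E]
    [NormedAddCommGroup F] [NormedSpace ℝ F] (m : ℕ) (g : E → F) (x : E) : F :=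
  ∑ k ∈ Finset.range (m + 1), (k.factorial : ℝ)⁻¹ • iteratedFDeriv ℝ k g 0 (fun _ => x)

/-- The map `x ↦ f(x, P(x))`. -/
def graphMap (u s : ℕ) (f : EF u s → EF u s) (P : Evec u → Evec s) (x : Evec u) : EF u s :=
  f ((WithLp.equiv 2 (Evec u × Evec s)).symm (x, P x))

open Filter Topology

lemma minNorm_le {E F : Type*} [NormedAddCommGroup E] [NormedSpace ℝ E]
    [NormedAddCommGroup F] [NormedSpace ℝ F] (A : E →L[ℝ] F) {ξ : ℝ} (h : ξ ≤ minNorm A) (v : E) :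
    ξ * ‖v‖ ≤ ‖A v‖ := by
  by_cases hv : v = 0
  · simp [hv]
  have hv' : 0 < ‖v‖ := norm_pos_iff.2 hv
  rw [← le_div_iff₀ hv']
  refine h.trans ?_
  unfold minNorm
  refine csSup_le ⟨0, le_rfl, by simp⟩ ?_
  rintro t ⟨_, ht⟩
  rw [le_div_iff₀ hv']
  exact ht v

lemma poly_contDiff {E F : Type*} [NormedAddCommGroup E] [NormedSpace ℝ E]
    [NormedAddCommGroup F] [NormedSpace ℝ F] (m : ℕ)
    (Pc : (k : ℕ) → ContinuousMultilinearMap ℝ (fun _ : Fin k => E) F) (P : E → F)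
    (hP : ∀ x, P x = ∑ k ∈ Finset.Icc 1 m, Pc k fun _ => x) (n : WithTop ℕ∞) :
    ContDiff ℝ n P := by
  have : P = fun x => ∑ k ∈ Finset.Icc 1 m, Pc k fun _ => x := funext hP
  rw [this]
  apply ContDiff.sum
  intro k _
  exact (Pc k).contDiff.comp (contDiff_pi.2 fun _ => contDiff_id)

lemma poly_bound {E F : Type*} [NormedAddCommGroup E] [NormedSpace ℝ E]
    [NormedAddCommGroup F] [NormedSpace ℝ F] (m : ℕ)
    (Pc : (k : ℕ) → ContinuousMultilinearMap ℝ (fun _ : Fin k => E) F) (P : E → F)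
    (hP : ∀ x, P x = ∑ k ∈ Finset.Icc 1 m, Pc k fun _ => x) (C : ℝ)
    (hC : ∀ k ∈ Finset.Icc 1 m, ‖Pc k‖ ≤ C) (i : ℕ) :
    ‖iteratedFDeriv ℝ i P 0‖ ≤ ∑ k ∈ Finset.Icc 1 m, (k.descFactorial i : ℝ) * C := by
  have : P = fun x => ∑ k ∈ Finset.Icc 1 m, Pc k fun _ => x := funext hP
  let d : (k : ℕ) → E →L[ℝ] (Fin k → E) := fun k => ContinuousLinearMap.pi fun _ => .id ℝ E
  have hd : ∀ k, ‖d k‖ ≤ 1 := fun k => by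
    apply ContinuousLinearMap.opNorm_le_bound _ zero_le_one
    intro x
    rw [one_mul]
    exact (pi_norm_le_iff_of_nonneg (norm_nonneg _)).2 fun _ => le_rfl
  have hcd : ∀ k ∈ Finset.Icc 1 m, ContDiff ℝ i (fun x => Pc k fun _ => x) := fun k _ =>
    (Pc k).contDiff.comp (contDiff_pi.2 fun _ => contDiff_id)
  rw [this, iteratedFDeriv_sum hcd, Finset.sum_apply]
  refine (norm_sum_le _ _).trans (Finset.sum_le_sum fun k hk => ?_)
  have e : (fun x => Pc k fun _ => x) = (Pc k) ∘ (d k) := rfl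
  rw [e, (d k).iteratedFDeriv_comp_right (n := i) (Pc k).contDiff 0 le_rfl]
  refine (ContinuousMultilinearMap.norm_compContinuousLinearMap_le _ _).trans ?_
  have h1 := (Pc k).norm_iteratedFDeriv_le i (d k 0)
  have h2 : ∏ _j : Fin i, ‖d k‖ ≤ 1 := Finset.prod_le_one (fun _ _ => norm_nonneg _) (fun _ _ => hd k)
  have h3 : ‖d k 0‖ ^ (Fintype.card (Fin k) - i) ≤ 1 := pow_le_one₀ (norm_nonneg _) (by simp)
  calc _ ≤ ‖iteratedFDeriv ℝ i (Pc k) (d k 0)‖ * 1 := by gcongr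
    _ ≤ (k.descFactorial i : ℝ) * ‖Pc k‖ * 1 := by
      rw [mul_one]; refine h1.trans ?_
      rw [Fintype.card_fin] at *
      gcongr
    _ ≤ _ := by rw [mul_one]; gcongr; exact hC k hk

lemma taylor_bound {E F : Type*} [NormedAddCommGroup E] [NormedSpace ℝ E]
    [NormedAddCommGroup F] [NormedSpace ℝ F] [CompleteSpace F] (n : ℕ) (g : E → F)
    (hg : ContDiffAt ℝ (n + 1) g 0) (A : ℝ) (hA : ‖iteratedFDeriv ℝ (n + 1) g 0‖ ≤ A) :
    ∀ᶠ x in 𝓝 (0 : E), ‖g x - taylorPoly n g x‖ ≤ (A + 1) * ‖x‖ ^ (n + 1) := by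
  have h1 : ∀ᶠ x in 𝓝 (0 : E), ContDiffAt ℝ (n + 1) g x := hg.eventually (by simp)
  have hc : ContinuousAt (iteratedFDeriv ℝ (n + 1) g) 0 :=
    (hg.iteratedFDeriv_right (i := n + 1) (m := 0) (by simp)).continuousAt
  have h2 : ∀ᶠ x in 𝓝 (0 : E), ‖iteratedFDeriv ℝ (n + 1) g x‖ < A + 1 :=
    hc.norm.eventually_lt_const (by linarith)
  obtain ⟨r, hr, hb⟩ := Metric.eventually_nhds_iff_ball.1 (h1.and h2)
  filter_upwards [Metric.ball_mem_nhds (0 : E) hr] with x hx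
  have hseg : ∀ t ∈ Icc (0 : ℝ) 1, (0 : E) + t • x ∈ Metric.ball (0 : E) r := by
    intro t ht
    rw [zero_add, mem_ball_zero_iff, norm_smul, Real.norm_of_nonneg ht.1]
    rw [mem_ball_zero_iff] at hx
    nlinarith [norm_nonneg x, ht.2]
  have key := map_add_eq_sum_add_integral_iteratedFDeriv (f := g) (x := 0) (y := x) (n := n)
    (fun t ht => (hb _ (hseg t ht)).1)
  rw [zero_add] at key
  have : g x - taylorPoly n g x = ((n.factorial : ℝ))⁻¹ •
      ∫ t in (0:ℝ)..1, (1 - t)^n • iteratedFDeriv ℝ (n + 1) g (0 + t • x) (fun _ ↦ x) := by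
    rw [sub_eq_iff_eq_add', taylorPoly]
    exact key
  rw [this, norm_smul]
  have hA0 : 0 ≤ A := (norm_nonneg _).trans hA
  have hI : ‖∫ t in (0:ℝ)..1, (1 - t)^n • iteratedFDeriv ℝ (n + 1) g (0 + t • x) (fun _ ↦ x)‖
      ≤ (A + 1) * ‖x‖ ^ (n + 1) * |(1:ℝ) - 0| := by
    apply intervalIntegral.norm_integral_le_of_norm_le_const
    intro t ht
    rw [uIoc_of_le zero_le_one] at ht
    have ht' : t ∈ Icc (0:ℝ) 1 := ⟨ht.1.le, ht.2⟩
    rw [norm_smul]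
    have a1 : ‖(1 - t)^n‖ ≤ 1 := by
      rw [Real.norm_of_nonneg (pow_nonneg (by linarith [ht.2]) _)]
      exact pow_le_one₀ (by linarith [ht.2]) (by linarith [ht.1])
    have a2 := (iteratedFDeriv ℝ (n + 1) g (0 + t • x)).le_opNorm (fun _ => x)
    rw [Finset.prod_const, Finset.card_univ, Fintype.card_fin] at a2
    have a3 := (hb _ (hseg t ht')).2.le
    calc _ ≤ 1 * (‖iteratedFDeriv ℝ (n + 1) g (0 + t • x)‖ * ‖x‖ ^ (n + 1)) := by gcongr
      _ ≤ _ := by rw [one_mul]; gcongr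
  have hfac : ‖((n.factorial : ℝ))⁻¹‖ ≤ 1 := by
    rw [norm_inv, Real.norm_natCast]
    exact inv_le_one_of_one_le₀ (by exact_mod_cast n.factorial_pos)
  calc _ ≤ 1 * ((A + 1) * ‖x‖ ^ (n + 1) * |(1:ℝ) - 0|) := by gcongr
    _ = _ := by simp

lemma emb_eq (u s : ℕ) (x : Evec u) (y : Evec s) :
    (WithLp.equiv 2 (Evec u × Evec s)).symm (x, y) = inX u s x + inY u s y := by
  apply (WithLp.equiv 2 (Evec u × Evec s)).injective
  ext <;> simp [inX, inY]

lemma proj_split (u s : ℕ) (z : EF u s) : z = inX u s (projX u s z) + inY u s (projY u s z) := by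
  rw [← emb_eq]
  rfl

lemma graphMap_eq (u s : ℕ) (f : EF u s → EF u s) (P : Evec u → Evec s) :
    graphMap u s f P = f ∘ (fun x => inX u s x + inY u s (P x)) := by
  funext x
  simp only [graphMap, emb_eq, Function.comp]

lemma comp_bound {E F G : Type*} [NormedAddCommGroup E] [NormedSpace ℝ E]
    [NormedAddCommGroup F] [NormedSpace ℝ F] [NormedAddCommGroup G] [NormedSpace ℝ G]
    (n : ℕ) (f : F → G) (D : Set F) (hD : D ∈ 𝓝 (0 : F)) (hf : ContDiffOn ℝ n f D)
    (C : ℝ) (hC : ∀ i ≤ n, ‖iteratedFDerivWithin ℝ i f D 0‖ ≤ C)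
    (j : E → F) (hj : ContDiff ℝ n j) (hj0 : j 0 = 0) (L : ℝ)
    (hL : ∀ i, 1 ≤ i → i ≤ n → ‖iteratedFDeriv ℝ i j 0‖ ≤ L ^ i) :
    ‖iteratedFDeriv ℝ n (f ∘ j) 0‖ ≤ n.factorial * C * L ^ n := by
  have ho : IsOpen (interior D) := isOpen_interior
  have h0 : (0 : F) ∈ interior D := mem_interior_iff_mem_nhds.2 hD
  have hso : IsOpen (j ⁻¹' interior D) := ho.preimage hj.continuous
  have h0s : (0 : E) ∈ j ⁻¹' interior D := by simpa [hj0] using h0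
  have hDe : D =ᶠ[𝓝 0] interior D := by
    filter_upwards [ho.mem_nhds h0] with y hy
    exact propext ⟨fun _ => hy, fun _ => interior_subset hy⟩
  have := norm_iteratedFDerivWithin_comp_le (𝕜 := ℝ) (g := f) (f := j) (n := n) (N := n)
    (hf.mono interior_subset) hj.contDiffOn le_rfl ho.uniqueDiffOn hso.uniqueDiffOn
    (fun x hx => hx) h0s (C := C) (D := L)
    (fun i hi => by
      rw [hj0, ← iteratedFDerivWithin_congr_set hDe]; exact hC i hi)
    (fun i h1 hi => by
      rw [iteratedFDerivWithin_of_isOpen i hso h0s]; exact hL i h1 hi)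
  rwa [iteratedFDerivWithin_of_isOpen n hso h0s] at this

lemma strict_est {u s : ℕ} {G : Type*} [NormedAddCommGroup G] [NormedSpace ℝ G]
    (h : EF u s → G) (h' : EF u s →L[ℝ] G) (hh : HasStrictFDerivAt h h' 0)
    (P : Evec u → Evec s) (hP : ContinuousAt P 0) (hP0 : P 0 = 0) (μ : ℝ)
    (hμ : ‖h'.comp (inY u s)‖ ≤ μ) (ε : ℝ) (hε : 0 < ε) :
    ∀ᶠ z in 𝓝 (0 : EF u s),
      ‖h z - h (inX u s (projX u s z) + inY u s (P (projX u s z)))‖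
        ≤ (μ + ε) * ‖projY u s z - P (projX u s z)‖ := by
  have hp : Tendsto (fun z : EF u s => inX u s (projX u s z) + inY u s (P (projX u s z)))
      (𝓝 0) (𝓝 0) := by
    have hc : ContinuousAt (fun z : EF u s => inX u s (projX u s z) + inY u s (P (projX u s z))) 0 := by
      have : ContinuousAt (fun z => P (projX u s z)) 0 :=
        ContinuousAt.comp (by simpa using hP) (projX u s).continuous.continuousAt
      exact ((inX u s).continuous.comp (projX u s).continuous).continuousAt.add
        ((inY u s).continuous.continuousAt.comp this)
    have := hc.tendsto
    simpa [hP0] using this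
  have ht : Tendsto (fun z : EF u s => (z, inX u s (projX u s z) + inY u s (P (projX u s z))))
      (𝓝 0) (𝓝 ((0, 0) : EF u s × EF u s)) := by
    rw [nhds_prod_eq]; exact tendsto_id.prodMk hp
  have hε' : 0 < ε / (‖inY u s‖ + 1) := by positivity
  have := ht.eventually (hh.isLittleO.def hε')
  filter_upwards [this] with z hz
  set w := projY u s z - P (projX u s z) with hw
  have e : z - (inX u s (projX u s z) + inY u s (P (projX u s z))) = inY u s w := by
    rw [sub_eq_iff_eq_add, hw, map_sub]
    refine (proj_split u s z).trans ?_
    abel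
  simp only [e] at hz
  have a1 : ‖h' (inY u s w)‖ ≤ μ * ‖w‖ := (h'.comp (inY u s)).le_of_opNorm_le hμ w
  have a2 : ε / (‖inY u s‖ + 1) * ‖inY u s w‖ ≤ ε * ‖w‖ := by
    have := (inY u s).le_opNorm w
    calc _ ≤ ε / (‖inY u s‖ + 1) * ((‖inY u s‖ + 1) * ‖w‖) := by
          gcongr; nlinarith [norm_nonneg w]
      _ = _ := by field_simp
  have a3 := norm_le_norm_add_norm_sub' (h z - h (inX u s (projX u s z) + inY u s (P (projX u s z))))
    (h' (inY u s w))
  linarith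

set_option maxHeartbeats 1000000 in
/-- Theorem 4.7 (propagation of order-`m` unstable cones):
there is `M* = M*(u,s,m,K,ρ)` such that for any `C^{m+1}` map `f` fixing `0` on a
convex bounded neighborhood `D` of `0`, with all derivatives of order `≤ m+1`
bounded by `C ≤ K`, any polynomials `P, Q` of degree `≤ m` vanishing at `0` with
symmetric multilinear coefficients bounded by `C` such that the degree-`m` Taylor
polynomial of `x ↦ f(x,P(x))` at `0` takes values in the graph of `Q`, and rate
constants `ξ, B, μ` with `1/ξ ≤ K`, `B ≤ K`, `μ/ξ^{m+1} < ρ`, for every `M > M*`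
there is `δ > 0` with `f(J_u(0,P,M,δ) ∩ D) ⊆ J_u(0,Q,M)`. -/
theorem stmt2 (u s : ℕ) (hu : 0 < u) (hs : 0 < s) (m : ℕ) (hm : 1 ≤ m)
    (K ρ : ℝ) (hK : 0 < K) (hρ0 : 0 < ρ) (hρ1 : ρ < 1) :
    ∃ Mstar : ℝ, 0 < Mstar ∧
      ∀ (D : Set (EF u s)), Convex ℝ D → Bornology.IsBounded D → D ∈ nhds (0 : EF u s) →
      ∀ f : EF u s → EF u s, ContDiffOn ℝ (m + 1) f D → f 0 = 0 →
      ∀ C : ℝ, C ≤ K →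
      (∀ z ∈ D, ∀ k ≤ m + 1, ‖iteratedFDerivWithin ℝ k f D z‖ ≤ C) →
      ∀ (P Q : Evec u → Evec s)
        (Pc Qc : (k : ℕ) → ContinuousMultilinearMap ℝ (fun _ : Fin k => Evec u) (Evec s)),
        (∀ (k : ℕ) (σ : Equiv.Perm (Fin k)) (v : Fin k → Evec u), Pc k (v ∘ σ) = Pc k v) →
        (∀ (k : ℕ) (σ : Equiv.Perm (Fin k)) (v : Fin k → Evec u), Qc k (v ∘ σ) = Qc k v) →
        (∀ x, P x = ∑ k ∈ Finset.Icc 1 m, Pc k fun _ => x) →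
        (∀ x, Q x = ∑ k ∈ Finset.Icc 1 m, Qc k fun _ => x) →
        (∀ k ∈ Finset.Icc 1 m, ‖Pc k‖ ≤ C) →
        (∀ k ∈ Finset.Icc 1 m, ‖Qc k‖ ≤ C) →
        (∀ x : Evec u,
          projY u s (taylorPoly m (graphMap u s f P) x)
            = Q (projX u s (taylorPoly m (graphMap u s f P) x))) →
      ∀ ξ B μ : ℝ, 0 < ξ → 1 / ξ ≤ K → 0 ≤ B → B ≤ K → 0 ≤ μ → μ / ξ ^ (m + 1) < ρ →
        ξ ≤ minNorm ((projX u s).comp ((fderiv ℝ f 0).comp (inX u s))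
              + ((projX u s).comp ((fderiv ℝ f 0).comp (inY u s))).comp (fderiv ℝ P 0)) →
        ‖(projX u s).comp ((fderiv ℝ f 0).comp (inY u s))‖ ≤ B →
        ‖(projY u s).comp ((fderiv ℝ f 0).comp (inY u s))
            - (fderiv ℝ Q 0).comp ((projX u s).comp ((fderiv ℝ f 0).comp (inY u s)))‖ ≤ μ →
      ∀ M : ℝ, Mstar < M →
        ∃ δ : ℝ, 0 < δ ∧ ∀ z ∈ D, ‖z‖ ≤ δ →
          ‖projY u s z - P (projX u s z)‖ ≤ M * ‖projX u s z‖ ^ (m + 1) →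
          ‖projY u s (f z) - Q (projX u s (f z))‖ ≤ M * ‖projX u s (f z)‖ ^ (m + 1) := by
  let NP : ℕ → ℝ := fun i => ∑ k ∈ Finset.Icc 1 m, (k.descFactorial i : ℝ) * K
  have hNP : ∀ i, 0 ≤ NP i := fun i => Finset.sum_nonneg fun k _ => by positivity
  let L : ℝ := 1 + ∑ i ∈ Finset.range (m + 2),
    (‖iteratedFDeriv ℝ i (inX u s) 0‖ + ‖inY u s‖ * NP i)
  have hL1 : 1 ≤ L := le_add_of_nonneg_right
    (Finset.sum_nonneg fun i _ => by have := hNP i; positivity)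
  let A : ℝ := (m + 1).factorial * K * L ^ (m + 1)
  have hA0 : 0 ≤ A := by positivity
  let c : ℝ := (‖projY u s‖ + (NP 1 + 1) * ‖projX u s‖) * (A + 1)
  have hc0 : 0 ≤ c := by have := hNP 1; positivity
  have h1ρ : 0 < 1 - ρ := by linarith
  refine ⟨c * K ^ (m + 1) / (1 - ρ) + 1, by positivity, ?_⟩
  intro D hDc hDb hD f hf hf0 C hCK hfC P Q Pc Qc _ _ hP hQ hPC hQC hT ξ B μ hξ hξK hB0 hBK hμ0
    hμξ hmin hB hμ M hM
  have hK0 : 0 ≤ K := hK.le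
  have hMpos : 0 < M := lt_trans (by positivity) hM
  have h0D : (0 : EF u s) ∈ D := mem_of_mem_nhds hD
  have hPcd : ∀ n : WithTop ℕ∞, ContDiff ℝ n P := poly_contDiff m Pc P hP
  have hQcd : ∀ n : WithTop ℕ∞, ContDiff ℝ n Q := poly_contDiff m Qc Q hQ
  have hz : ∀ (Rc : (k : ℕ) → ContinuousMultilinearMap ℝ (fun _ : Fin k => Evec u) (Evec s)),
      ∑ k ∈ Finset.Icc 1 m, (Rc k fun _ => (0 : Evec u)) = 0 := fun Rc =>
    Finset.sum_eq_zero fun k hk => by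
      have : 0 < k := (Finset.mem_Icc.1 hk).1
      exact (Rc k).map_coord_zero ⟨0, this⟩ rfl
  have hP0 : P 0 = 0 := by rw [hP, hz]
  have hQ0 : Q 0 = 0 := by rw [hQ, hz]
  have hPb : ∀ i, ‖iteratedFDeriv ℝ i P 0‖ ≤ NP i :=
    poly_bound m Pc P hP K (fun k hk => (hPC k hk).trans hCK)
  have hQb : ∀ i, ‖iteratedFDeriv ℝ i Q 0‖ ≤ NP i :=
    poly_bound m Qc Q hQ K (fun k hk => (hQC k hk).trans hCK)
  have hfat : ContDiffAt ℝ (m + 1) f 0 := hf.contDiffAt hD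
  have hfs : HasStrictFDerivAt f (fderiv ℝ f 0) 0 := hfat.hasStrictFDerivAt (by simp)
  have hQs : HasStrictFDerivAt Q (fderiv ℝ Q 0) 0 :=
    (hQcd 1).contDiffAt.hasStrictFDerivAt (by simp)
  have hPs : HasFDerivAt P (fderiv ℝ P 0) 0 :=
    ((hPcd 1).contDiffAt.hasStrictFDerivAt (by simp)).hasFDerivAt
  let j : Evec u → EF u s := fun x => inX u s x + inY u s (P x)
  have hjdef : ∀ x, j x = inX u s x + inY u s (P x) := fun _ => rfl
  have hj0 : j 0 = 0 := by simp [j, hP0]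
  have hjcd : ∀ n : WithTop ℕ∞, ContDiff ℝ n j := fun n =>
    (inX u s).contDiff.add ((inY u s).contDiff.comp (hPcd n))
  have hjL : ∀ i, 1 ≤ i → i ≤ m + 1 → ‖iteratedFDeriv ℝ i j 0‖ ≤ L ^ i := by
    intro i h1 hi
    have e : iteratedFDeriv ℝ i j 0 = iteratedFDeriv ℝ i (inX u s) 0
        + iteratedFDeriv ℝ i (inY u s ∘ P) 0 :=
      iteratedFDeriv_add_apply (inX u s).contDiff.contDiffAt
        ((inY u s).contDiff.comp (hPcd i)).contDiffAt
    have e2 : ‖iteratedFDeriv ℝ i (inY u s ∘ P) 0‖ ≤ ‖inY u s‖ * NP i := by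
      refine ((inY u s).norm_iteratedFDeriv_comp_left (hPcd i).contDiffAt le_rfl).trans ?_
      gcongr; exact hPb i
    have e3 : ‖iteratedFDeriv ℝ i (inX u s) 0‖ + ‖inY u s‖ * NP i ≤
        ∑ i ∈ Finset.range (m + 2), (‖iteratedFDeriv ℝ i (inX u s) 0‖ + ‖inY u s‖ * NP i) :=
      Finset.single_le_sum
        (f := fun i => ‖iteratedFDeriv ℝ i (inX u s) 0‖ + ‖inY u s‖ * NP i)
        (fun i _ => by have := hNP i; positivity) (Finset.mem_range.2 (by omega))
    have e4 : ‖iteratedFDeriv ℝ i j 0‖ ≤ L := by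
      rw [e]
      have := norm_add_le (iteratedFDeriv ℝ i (inX u s) 0) (iteratedFDeriv ℝ i (inY u s ∘ P) 0)
      simp only [L]; linarith
    calc _ ≤ L := e4
      _ ≤ L ^ i := le_self_pow₀ hL1 (by omega)
  have hg : graphMap u s f P = f ∘ j := graphMap_eq u s f P
  have hgA : ‖iteratedFDeriv ℝ (m + 1) (f ∘ j) 0‖ ≤ A :=
    comp_bound (m + 1) f D hD (by exact_mod_cast hf) K
      (fun i hi => (hfC 0 h0D i hi).trans hCK) j (hjcd _) hj0 L hjL
  have hgcd : ContDiffAt ℝ (m + 1) (f ∘ j) 0 :=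
    ContDiffAt.comp 0 (by rw [hj0]; exact hfat) (hjcd _).contDiffAt
  have hTay := taylor_bound m (f ∘ j) hgcd A hgA
  rw [hg] at hT
  -- the curve bound
  have hTc : Continuous (taylorPoly m (f ∘ j)) := by
    unfold taylorPoly
    refine continuous_finsetSum _ fun k _ => ?_
    have : Continuous fun x : Evec u => iteratedFDeriv ℝ k (f ∘ j) 0 (fun _ => x) :=
      (iteratedFDeriv ℝ k (f ∘ j) 0).cont.comp (continuous_pi fun _ => continuous_id)
    exact this.const_smul ((k.factorial : ℝ)⁻¹)
  have hT0 : taylorPoly m (f ∘ j) 0 = 0 := by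
    have := hTay.self_of_nhds
    simpa [hj0, hf0] using this
  have hQ1 : ‖fderiv ℝ Q 0‖ ≤ NP 1 := by
    have := hQb 1
    rwa [norm_iteratedFDeriv_one] at this
  have hcurve : ∀ᶠ x in 𝓝 (0 : Evec u),
      ‖projY u s (f (j x)) - Q (projX u s (f (j x)))‖ ≤ c * ‖x‖ ^ (m + 1) := by
    have t1 : Tendsto (fun x => projX u s (f (j x))) (𝓝 0) (𝓝 0) := by
      have := ((projX u s).continuous.continuousAt.comp hgcd.continuousAt).tendsto
      simpa [hj0, hf0, Function.comp_def] using this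
    have t2 : Tendsto (fun x => projX u s (taylorPoly m (f ∘ j) x)) (𝓝 0) (𝓝 0) := by
      have := ((projX u s).continuous.comp hTc).tendsto 0
      rw [Function.comp_apply, hT0, map_zero] at this
      exact this
    have t3 : Tendsto (fun x => (projX u s (f (j x)), projX u s (taylorPoly m (f ∘ j) x)))
        (𝓝 0) (𝓝 ((0, 0) : Evec u × Evec u)) := by
      rw [nhds_prod_eq]; exact t1.prodMk t2
    filter_upwards [hTay, t3.eventually (hQs.isLittleO.def one_pos)] with x hx hq
    simp only [Function.comp_apply] at hx
    set a := f (j x)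
    set T := taylorPoly m (f ∘ j) x with hTdef
    have e : projY u s a - Q (projX u s a) = projY u s (a - T)
        - (Q (projX u s a) - Q (projX u s T)) := by
      rw [map_sub, hTdef, hT x]; abel
    have b1 : ‖projX u s a - projX u s T‖ ≤ ‖projX u s‖ * ‖a - T‖ := by
      rw [← map_sub]; exact (projX u s).le_opNorm _
    have b2 : ‖Q (projX u s a) - Q (projX u s T)‖ ≤ (NP 1 + 1) * ‖projX u s a - projX u s T‖ := by
      have := norm_le_norm_add_norm_sub' (Q (projX u s a) - Q (projX u s T))
        (fderiv ℝ Q 0 (projX u s a - projX u s T))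
      have h2 := (fderiv ℝ Q 0).le_of_opNorm_le hQ1 (projX u s a - projX u s T)
      linarith
    have b3 := (projY u s).le_opNorm (a - T)
    have := hNP 1
    calc _ ≤ ‖projY u s (a - T)‖ + ‖Q (projX u s a) - Q (projX u s T)‖ := by
          rw [e]; exact norm_sub_le _ _
      _ ≤ ‖projY u s‖ * ‖a - T‖ + (NP 1 + 1) * (‖projX u s‖ * ‖a - T‖) := by
          refine add_le_add b3 (b2.trans ?_); gcongr
      _ = (‖projY u s‖ + (NP 1 + 1) * ‖projX u s‖) * ‖a - T‖ := by ring
      _ ≤ (‖projY u s‖ + (NP 1 + 1) * ‖projX u s‖) * ((A + 1) * ‖x‖ ^ (m + 1)) := by gcongr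
      _ = _ := by ring
  clear_value c
  -- choice of the margin
  have hstrict : c + μ * M < M * ξ ^ (m + 1) := by
    have h1 : 1 ≤ K * ξ := (div_le_iff₀ hξ).1 hξK
    have h2 : 1 ≤ K ^ (m + 1) * ξ ^ (m + 1) := by rw [← mul_pow]; exact one_le_pow₀ h1
    have hξp : 0 < ξ ^ (m + 1) := by positivity
    have h3 : μ < ρ * ξ ^ (m + 1) := (div_lt_iff₀ hξp).1 hμξ
    have h4 : c * K ^ (m + 1) < M * (1 - ρ) := by
      rw [← div_lt_iff₀ h1ρ]; linarith
    have h5 : c * K ^ (m + 1) * ξ ^ (m + 1) < M * (1 - ρ) * ξ ^ (m + 1) := by gcongr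
    have h6 : c * 1 ≤ c * (K ^ (m + 1) * ξ ^ (m + 1)) := by gcongr
    have h7 : μ * M < ρ * ξ ^ (m + 1) * M := by gcongr
    nlinarith
  obtain ⟨η, hη1, hηξ, hη0⟩ : ∃ η : ℝ, c + (μ + η) * M < M * (ξ - η) ^ (m + 1) ∧ η < ξ ∧ 0 < η := by
    have ca : Tendsto (fun η : ℝ => c + (μ + η) * M) (𝓝 0) (𝓝 (c + (μ + 0) * M)) :=
      Continuous.tendsto (by fun_prop) 0
    have cb : Tendsto (fun η : ℝ => M * (ξ - η) ^ (m + 1)) (𝓝 0) (𝓝 (M * (ξ - 0) ^ (m + 1))) :=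
      Continuous.tendsto (by fun_prop) 0
    have h1 := ca.eventually_lt cb (by simpa using hstrict)
    have h2 : ∀ᶠ η : ℝ in 𝓝 0, η < ξ := Iio_mem_nhds hξ
    have h3 : ∀ᶠ η : ℝ in 𝓝[>] 0, 0 < η := self_mem_nhdsWithin
    obtain ⟨η, ha, hb⟩ := (((h1.and h2).filter_mono nhdsWithin_le_nhds).and h3).exists
    exact ⟨η, ha.1, ha.2, hb⟩
  -- lower bound along the curve
  have hlow : ∀ᶠ x in 𝓝 (0 : Evec u), (ξ - η / 2) * ‖x‖ ≤ ‖projX u s (f (j x))‖ := by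
    have hjd : HasFDerivAt j (inX u s + (inY u s).comp (fderiv ℝ P 0)) 0 :=
      (inX u s).hasFDerivAt.add ((inY u s).hasFDerivAt.comp 0 hPs)
    have hfd : HasFDerivAt f (fderiv ℝ f 0) (j 0) := by rw [hj0]; exact hfs.hasFDerivAt
    have hd := (projX u s).hasFDerivAt.comp (0 : Evec u) (hfd.comp 0 hjd)
    filter_upwards [hd.isLittleO.def (half_pos hη0)] with x hx
    simp only [Function.comp_apply, hj0, hf0, map_zero, sub_zero] at hx
    have hm' := minNorm_le _ hmin x
    simp only [ContinuousLinearMap.comp_apply, ContinuousLinearMap.add_apply, map_add] at hx hm'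
    have := norm_le_norm_add_norm_sub (projX u s (f (j x)))
      ((projX u s) ((fderiv ℝ f 0) ((inX u s) x)) +
        (projX u s) ((fderiv ℝ f 0) ((inY u s) ((fderiv ℝ P 0) x))))
    linarith
  have hPcont : ContinuousAt P 0 := (hPcd 0).continuous.continuousAt
  have hXs : HasStrictFDerivAt (fun z => projX u s (f z)) ((projX u s).comp (fderiv ℝ f 0)) 0 :=
    (projX u s).hasStrictFDerivAt.comp 0 hfs
  have hY : HasStrictFDerivAt (fun z => projY u s (f z) - Q (projX u s (f z)))
      ((projY u s).comp (fderiv ℝ f 0) - (fderiv ℝ Q 0).comp ((projX u s).comp (fderiv ℝ f 0))) 0 :=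
    ((projY u s).hasStrictFDerivAt.comp 0 hfs).sub
      (HasStrictFDerivAt.comp (0 : EF u s) (g := Q) (f := fun z => projX u s (f z))
        (by simpa [hf0] using hQs) hXs)
  have E1 := strict_est _ _ hXs P hPcont hP0 B hB 1 one_pos
  have E2 := strict_est _ _ hY P hPcont hP0 μ hμ η hη0
  have tX : Tendsto (projX u s) (𝓝 0) (𝓝 0) := by
    simpa using (projX u s).continuous.tendsto 0
  have hsm : ∀ᶠ x in 𝓝 (0 : Evec u), (B + 1) * M * ‖x‖ ^ m < η / 2 := by
    have : Tendsto (fun x : Evec u => (B + 1) * M * ‖x‖ ^ m) (𝓝 0)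
        (𝓝 ((B + 1) * M * ‖(0 : Evec u)‖ ^ m)) := Continuous.tendsto (by fun_prop) 0
    refine this.eventually_lt_const ?_
    rw [norm_zero, zero_pow (by omega), mul_zero]
    exact half_pos hη0
  have hall := E1.and (E2.and (tX.eventually (hsm.and (hlow.and hcurve))))
  obtain ⟨r, hr, hball⟩ := Metric.eventually_nhds_iff_ball.1 hall
  refine ⟨r / 2, half_pos hr, fun z _ hzr hcone => ?_⟩
  obtain ⟨F1, F2, F3, F4, F5⟩ := hball z (by rw [mem_ball_zero_iff]; linarith)
  simp only [← hjdef] at F1 F2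
  set x := projX u s z
  set w := projY u s z - P x
  have hx0 : 0 ≤ ‖x‖ := norm_nonneg x
  have G1 : (ξ - η) * ‖x‖ ≤ ‖projX u s (f z)‖ := by
    have h1 : (B + 1) * ‖w‖ ≤ (B + 1) * (M * ‖x‖ ^ (m + 1)) := by gcongr
    have h2 : (B + 1) * M * ‖x‖ ^ m * ‖x‖ ≤ η / 2 * ‖x‖ := by gcongr
    have h3 := norm_le_norm_add_norm_sub (projX u s (f z)) (projX u s (f (j x)))
    have h4 : (B + 1) * (M * ‖x‖ ^ (m + 1)) = (B + 1) * M * ‖x‖ ^ m * ‖x‖ := by ring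
    linarith
  have G2 : ‖projY u s (f z) - Q (projX u s (f z))‖ ≤ (c + (μ + η) * M) * ‖x‖ ^ (m + 1) := by
    have h1 : (μ + η) * ‖w‖ ≤ (μ + η) * (M * ‖x‖ ^ (m + 1)) := by gcongr
    have h3 := norm_le_norm_add_norm_sub' (projY u s (f z) - Q (projX u s (f z)))
      (projY u s (f (j x)) - Q (projX u s (f (j x))))
    linarith
  have hηξ' : 0 ≤ ξ - η := by linarith
  calc _ ≤ _ := G2
    _ ≤ M * (ξ - η) ^ (m + 1) * ‖x‖ ^ (m + 1) := by gcongr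
    _ = M * ((ξ - η) * ‖x‖) ^ (m + 1) := by rw [mul_pow, mul_assoc]
    _ ≤ _ := by gcongr
end
end

section
/- Fix integers u, s ≥ 1 and m ≥ 1, and reals K > 0 and ρ ∈ (0,1). There exists M* > 0, depending only on u, s, m, K, ρ, with the following property. Let U ⊆ ℝ^u × ℝ^s be a convex bounded neighborhood of 0 and f : U → ℝ^u × ℝ^s a C^{m+1} map with f(0) = 0 all of whose derivatives of order ≤ m+1 are bounded in norm by some c ≤ K on U, and suppose the x-component of f has vanishing pure-y derivatives at 0 up to order m: for 1 ≤ j ≤ m, D^j(π_x ∘ f)(0)(h₁,…,h_j) = 0 whenever h₁,…,h_j ∈ {0} × ℝ^s. Suppose there are ξ > 0, B ≥ 0, μ ≥ 0 with 1/ξ ≤ K, B ≤ K and μ^{m+1}/ξ < ρ such that m(∂f_x/∂x(0)) ≥ ξ, ‖∂f_y/∂x(0)‖ ≤ B, and ‖∂f_y/∂y(0)‖ ≤ μ. Then for every M > M* there exists δ > 0 such that for all (x,y) ∈ U with ‖(x,y)‖ ≤ δ and ‖x‖ > M‖y‖^{m+1}, one has ‖π_x f(x,y)‖ > M‖π_y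 f(x,y)‖^{m+1} (i.e. f maps the complement of the order-m stable cone, intersected with B̄(0,δ) ∩ U, into the complement of the order-m stable cone). -/
noncomputable section

open Metric Set

theorem taylor_aux {E F : Type*} [NormedAddCommGroup E] [NormedSpace ℝ E]
    [NormedAddCommGroup F] [NormedSpace ℝ F] (g : E → F) (m : ℕ) (R C : ℝ)
    (hg : ContDiffOn ℝ (m + 1) g (ball 0 R))
    (hC : ∀ z ∈ ball (0 : E) R, ‖iteratedFDeriv ℝ (m + 1) g z‖ ≤ C) (v : E)
    (hv : v ∈ ball (0 : E) R)
    (h0 : ∀ j ≤ m, iteratedFDeriv ℝ j g 0 (fun _ => v) = 0) :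
    ‖g v‖ ≤ C * ‖v‖ ^ (m + 1) := by
  set L : ℝ →L[ℝ] E := ContinuousLinearMap.toSpanSingleton ℝ v with hL
  have hLt : ∀ t, L t = t • v := fun t => by simp [hL]
  have hmem : ∀ t ∈ Icc (0 : ℝ) 1, L t ∈ ball (0 : E) R := by
    intro t ht
    rw [hLt, mem_ball_zero_iff, norm_smul]
    rw [mem_ball_zero_iff] at hv
    have : ‖t‖ ≤ 1 := by rw [Real.norm_eq_abs, abs_of_nonneg ht.1]; exact ht.2
    nlinarith [norm_nonneg v]
  have hopen : IsOpen (L ⁻¹' ball (0 : E) R) := isOpen_ball.preimage L.continuous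
  have hcd : ContDiffOn ℝ (m + 1) (g ∘ L) (L ⁻¹' ball (0 : E) R) :=
    hg.comp L.contDiff.contDiffOn (fun x hx => hx)
  have hD : ∀ k : ℕ, k ≤ m + 1 → ∀ t ∈ Icc (0 : ℝ) 1,
      iteratedDerivWithin k (g ∘ L) (Icc 0 1) t = iteratedFDeriv ℝ k g (L t) (fun _ => v) := by
    intro k hk t ht
    have hk' : (k : WithTop ℕ∞) ≤ m + 1 := by exact_mod_cast hk
    rw [iteratedDerivWithin_eq_iteratedDeriv (uniqueDiffOn_Icc zero_lt_one)
      ((hcd.contDiffAt (hopen.mem_nhds (hmem t ht))).of_le hk') ht,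
      iteratedDeriv_eq_iteratedFDeriv, ← iteratedFDerivWithin_of_isOpen k hopen (hmem t ht),
      L.iteratedFDerivWithin_comp_right hg isOpen_ball.uniqueDiffOn hopen.uniqueDiffOn
        (hmem t ht) hk', iteratedFDerivWithin_of_isOpen k isOpen_ball (hmem t ht)]
    simp [hLt]
  have hT := taylor_mean_remainder_bound (f := g ∘ L) (a := 0) (b := 1) (x := 1) (n := m)
    (C := C * ‖v‖ ^ (m + 1)) zero_le_one (hcd.mono hmem) (by simp) (by
      intro t ht
      rw [hD _ le_rfl t ht]
      refine (ContinuousMultilinearMap.le_opNorm _ _).trans ?_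
      simp only [Finset.prod_const, Finset.card_univ, Fintype.card_fin]
      gcongr
      exact hC _ (hmem t ht))
  have hz : taylorWithinEval (g ∘ L) m (Icc 0 1) 0 1 = 0 := by
    rw [taylor_within_apply]
    refine Finset.sum_eq_zero fun k hk => ?_
    have hk' : k ≤ m := by simpa [Nat.lt_succ_iff] using hk
    rw [hD k (by omega) 0 (by simp)]
    have : L 0 = 0 := map_zero L
    rw [this, h0 k hk', smul_zero]
  rw [hz] at hT
  simp only [Function.comp, hLt, one_smul, sub_zero, one_pow, mul_one] at hT
  refine hT.trans (div_le_self ?_ ?_)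
  · have : 0 ≤ C := (norm_nonneg _).trans (hC v hv)
    positivity
  · exact_mod_cast Nat.succ_le_of_lt (Nat.factorial_pos m)

theorem pow_aux (a b : ℝ) (ha : 0 ≤ a) (hb : 0 ≤ b) (k : ℕ) :
    (a + b) ^ (k + 1) ≤ b ^ (k + 1) + (k + 1) * a * (a + b) ^ k := by
  induction k with
  | zero => simp; linarith
  | succ k ih =>
    have h1 : b ^ (k + 1) ≤ (a + b) ^ (k + 1) := by gcongr; linarith
    have h2 := mul_le_mul_of_nonneg_left ih (add_nonneg ha hb)
    have h3 := mul_le_mul_of_nonneg_left h1 ha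
    push_cast
    calc (a + b) ^ (k + 1 + 1) = (a + b) * (a + b) ^ (k + 1) := by ring
      _ ≤ _ := h2
      _ = b ^ (k + 1 + 1) + a * b ^ (k + 1) + (k + 1) * a * (a + b) ^ (k + 1) := by ring
      _ ≤ b ^ (k + 1 + 1) + a * (a + b) ^ (k + 1) + (k + 1) * a * (a + b) ^ (k + 1) := by linarith
      _ = _ := by ring

theorem minNorm_aux {E F : Type*} [NormedAddCommGroup E] [NormedSpace ℝ E]
    [NormedAddCommGroup F] [NormedSpace ℝ F] (A : E →L[ℝ] F) (ξ : ℝ) (h : ξ ≤ minNorm A) (v : E) :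
    ξ * ‖v‖ ≤ ‖A v‖ := by
  by_cases hv : v = 0
  · simp [hv]
  have hv' : 0 < ‖v‖ := norm_pos_iff.mpr hv
  rw [← le_div_iff₀ hv']
  refine h.trans (csSup_le ⟨0, by simp⟩ ?_)
  rintro t ⟨_, ht⟩
  rw [le_div_iff₀ hv']
  exact ht v

theorem projX_le {u s : ℕ} (z : EF u s) : ‖projX u s z‖ ≤ ‖z‖ := by
  have h := WithLp.prod_norm_sq_eq_of_L2 z
  have : projX u s z = z.fst := rfl
  rw [this]
  exact abs_le_of_sq_le_sq' (by nlinarith [sq_nonneg ‖z.snd‖]) (norm_nonneg _) |>.2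

theorem projY_le {u s : ℕ} (z : EF u s) : ‖projY u s z‖ ≤ ‖z‖ := by
  have h := WithLp.prod_norm_sq_eq_of_L2 z
  have : projY u s z = z.snd := rfl
  rw [this]
  exact abs_le_of_sq_le_sq' (by nlinarith [sq_nonneg ‖z.fst‖]) (norm_nonneg _) |>.2

theorem norm_inX {u s : ℕ} (x : Evec u) : ‖inX u s x‖ = ‖x‖ := by
  have h := WithLp.prod_norm_sq_eq_of_L2 (inX u s x)
  have h1 : (inX u s x).fst = x := rfl
  have h2 : (inX u s x).snd = 0 := rfl
  rw [h1, h2] at h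
  simpa using h

theorem norm_inY {u s : ℕ} (y : Evec s) : ‖inY u s y‖ = ‖y‖ := by
  have h := WithLp.prod_norm_sq_eq_of_L2 (inY u s y)
  have h1 : (inY u s y).fst = 0 := rfl
  have h2 : (inY u s y).snd = y := rfl
  rw [h1, h2] at h
  simpa using h

theorem decomp {u s : ℕ} (z : EF u s) :
    z = inX u s (projX u s z) + inY u s (projY u s z) := by
  have h1 : (inX u s (projX u s z) + inY u s (projY u s z)).fst = z.fst + 0 := rfl
  have h2 : (inX u s (projX u s z) + inY u s (projY u s z)).snd = 0 + z.snd := rfl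
  rw [add_zero] at h1
  rw [zero_add] at h2
  apply (WithLp.equiv 2 (Evec u × Evec s)).injective
  exact Prod.ext h1.symm h2.symm

theorem eps_aux (ξ κ μ B M : ℝ) (m : ℕ) (hm : 1 ≤ m) (h : 0 < ξ - κ - μ ^ (m + 1)) :
    ∃ ε : ℝ, 0 < ε ∧ 0 < ξ - ε - κ - (μ + ε) ^ (m + 1)
      - M * ((m + 1) * (B + ε) * (((B + ε) + (μ + ε)) * ε) ^ m) := by
  have hc : Continuous (fun ε : ℝ => ξ - ε - κ - (μ + ε) ^ (m + 1)
      - M * ((m + 1) * (B + ε) * (((B + ε) + (μ + ε)) * ε) ^ m)) := by fun_prop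
  have h0 : 0 < (fun ε : ℝ => ξ - ε - κ - (μ + ε) ^ (m + 1)
      - M * ((m + 1) * (B + ε) * (((B + ε) + (μ + ε)) * ε) ^ m)) 0 := by
    have : m ≠ 0 := by omega
    simpa [this] using h
  have hev := (hc.tendsto 0).eventually (lt_mem_nhds h0)
  obtain ⟨r, hr, H⟩ := Metric.eventually_nhds_iff.mp hev
  exact ⟨r / 2, by positivity, H (by
    rw [Real.dist_eq, sub_zero, abs_of_pos (by positivity)]; linarith)⟩

set_option maxHeartbeats 2000000 in
/-- Lemma B.5 (stable jets in a good frame, complements of cones): there is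
`M* = M*(u,s,m,K,ρ)` such that for any `C^{m+1}` map `f` fixing `0` on a convex
bounded neighborhood `U` of `0` with all derivatives of order `≤ m+1` bounded by
`c ≤ K`, whose `x`-component has vanishing pure-`y` derivatives at `0` up to
order `m`, and rate constants `ξ, B, μ` with `1/ξ ≤ K`, `B ≤ K`, `μ^{m+1}/ξ < ρ`,
for every `M > M*` there is `δ > 0` such that `f` maps
`{‖x‖ > M‖y‖^{m+1}} ∩ B̄(0,δ) ∩ U` into `{‖x‖ > M‖y‖^{m+1}}`. -/
theorem stmt4 (u s : ℕ) (hu : 0 < u) (hs : 0 < s) (m : ℕ) (hm : 1 ≤ m)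
    (K ρ : ℝ) (hK : 0 < K) (hρ0 : 0 < ρ) (hρ1 : ρ < 1) :
    ∃ Mstar : ℝ, 0 < Mstar ∧
      ∀ (U : Set (EF u s)), Convex ℝ U → Bornology.IsBounded U → U ∈ nhds (0 : EF u s) →
      ∀ f : EF u s → EF u s, ContDiffOn ℝ (m + 1) f U → f 0 = 0 →
      ∀ c : ℝ, c ≤ K →
      (∀ z ∈ U, ∀ k ≤ m + 1, ‖iteratedFDerivWithin ℝ k f U z‖ ≤ c) →
      (∀ j : ℕ, 1 ≤ j → j ≤ m → ∀ h : Fin j → Evec s,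
        iteratedFDeriv ℝ j (fun z => projX u s (f z)) 0 (fun i => inY u s (h i)) = 0) →
      ∀ ξ B μ : ℝ, 0 < ξ → 1 / ξ ≤ K → 0 ≤ B → B ≤ K → 0 ≤ μ → μ ^ (m + 1) / ξ < ρ →
        ξ ≤ minNorm ((projX u s).comp ((fderiv ℝ f 0).comp (inX u s))) →
        ‖(projY u s).comp ((fderiv ℝ f 0).comp (inX u s))‖ ≤ B →
        ‖(projY u s).comp ((fderiv ℝ f 0).comp (inY u s))‖ ≤ μ →
      ∀ M : ℝ, Mstar < M →
        ∃ δ : ℝ, 0 < δ ∧ ∀ z ∈ U, ‖z‖ ≤ δ →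
          M * ‖projY u s z‖ ^ (m + 1) < ‖projX u s z‖ →
          M * ‖projY u s (f z)‖ ^ (m + 1) < ‖projX u s (f z)‖ := by
  refine ⟨K ^ 2 / (1 - ρ), by have : 0 < 1 - ρ := by linarith
                              positivity, ?_⟩
  intro U _ _ hU f hf hf0 c hcK hbd hjet ξ B μ hξ hξK hB0 hBK hμ hμξ hA hfB hfμ M hM
  have h1ρ : 0 < 1 - ρ := by linarith
  have hM0 : 0 < M := lt_trans (by positivity) hM
  have hgap : 0 < ξ - K / M - μ ^ (m + 1) := by
    rw [div_lt_iff₀ hξ] at hμξ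
    rw [div_le_iff₀ hξ] at hξK
    rw [div_lt_iff₀ h1ρ] at hM
    have : K / M < ξ * (1 - ρ) := by
      rw [div_lt_iff₀ hM0]
      have h1 : K ^ 2 * ξ < M * (1 - ρ) * ξ := mul_lt_mul_of_pos_right hM hξ
      nlinarith
    nlinarith
  obtain ⟨ε, hε, hφ⟩ := eps_aux ξ (K / M) μ B M m hm hgap
  obtain ⟨R, hR, hRU⟩ := Metric.mem_nhds_iff.mp hU
  have hcda : ∀ z ∈ ball (0 : EF u s) R, ContDiffAt ℝ (m + 1) f z := fun z hz =>
    hf.contDiffAt (Filter.mem_of_superset (isOpen_ball.mem_nhds hz) hRU)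
  have hsd := (hcda 0 (mem_ball_self hR)).hasStrictFDerivAt (by simp)
  obtain ⟨r, hr, hstrict⟩ := Metric.eventually_nhds_iff.mp
    ((Asymptotics.isLittleO_iff.mp hsd.isLittleO) hε)
  set D := fderiv ℝ f 0 with hDdef
  have hst : ∀ p q : EF u s, ‖p‖ < r → ‖q‖ < r → ‖f p - f q - D (p - q)‖ ≤ ε * ‖p - q‖ := by
    intro p q hp hq
    refine hstrict (y := (p, q)) ?_
    rw [dist_eq_norm, Prod.norm_def]
    simp [hp, hq]
  have htay : ∀ y : Evec s, ‖y‖ < R → ‖projX u s (f (inY u s y))‖ ≤ K * ‖y‖ ^ (m + 1) := by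
    intro y hy
    have := taylor_aux (fun z => projX u s (f z)) m R K
      (fun z hz => ((projX u s).contDiff.contDiffAt.comp z (hcda z hz)).contDiffWithinAt) ?_
      (inY u s y) (by rwa [mem_ball_zero_iff, norm_inY]) ?_
    · rwa [norm_inY] at this
    · intro z hz
      have h1 := (projX u s).iteratedFDeriv_comp_left (hcda z hz) (i := m + 1)
        (by exact_mod_cast le_rfl)
      have h2 := hbd z (hRU hz) (m + 1) le_rfl
      rw [iteratedFDerivWithin_congr_set (Filter.eventuallyEq_univ.mpr
        (Filter.mem_of_superset (isOpen_ball.mem_nhds hz) hRU)), iteratedFDerivWithin_univ] at h2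
      have h3 : ‖projX u s‖ ≤ 1 :=
        ContinuousLinearMap.opNorm_le_bound _ zero_le_one (fun z => by simpa using projX_le z)
      change ‖iteratedFDeriv ℝ (m + 1) (projX u s ∘ f) z‖ ≤ K
      rw [h1]
      refine (ContinuousLinearMap.norm_compContinuousMultilinearMap_le _ _).trans ?_
      nlinarith [norm_nonneg (iteratedFDeriv ℝ (m + 1) f z)]
    · intro j hj
      rcases Nat.eq_zero_or_pos j with rfl | hj0
      · simp [hf0]
      · exact hjet j hj0 hj (fun _ => y)
  refine ⟨min ε (min (r / 2) (R / 2)), by positivity, ?_⟩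
  intro z _ hz hcone
  have hzε : ‖z‖ ≤ ε := hz.trans (min_le_left _ _)
  have hzr : ‖z‖ < r := by
    have : ‖z‖ ≤ r / 2 := hz.trans ((min_le_right _ _).trans (min_le_left _ _))
    linarith
  have hzR : ‖z‖ < R := by
    have : ‖z‖ ≤ R / 2 := hz.trans ((min_le_right _ _).trans (min_le_right _ _))
    linarith
  have hxz := projX_le z
  have hyz := projY_le z
  have hdec := decomp z
  set x := projX u s z with hx
  set y := projY u s z with hy
  have hx0 : 0 < ‖x‖ := lt_of_le_of_lt (by positivity) hcone
  have hynn : 0 ≤ ‖y‖ := norm_nonneg y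
  -- lower bound
  have e1 := hst z (inY u s y) hzr (by rw [norm_inY]; linarith)
  have hd1 : z - inY u s y = inX u s x := by rw [hdec]; abel
  rw [hd1, norm_inX] at e1
  have e2 := (projX_le _).trans e1
  rw [map_sub, map_sub] at e2
  have e3 : ξ * ‖x‖ ≤ ‖projX u s (D (inX u s x))‖ := minNorm_aux _ ξ hA x
  have e4 := htay y (by linarith)
  have lower : (ξ - ε) * ‖x‖ - K * ‖y‖ ^ (m + 1) ≤ ‖projX u s (f z)‖ := by
    have := norm_sub_norm_le (projX u s (D (inX u s x)))
      (-(projX u s (f z) - projX u s (f (inY u s y)) - projX u s (D (inX u s x))))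
    rw [norm_neg, sub_neg_eq_add] at this
    have e5 : projX u s (D (inX u s x)) + (projX u s (f z) - projX u s (f (inY u s y))
      - projX u s (D (inX u s x))) = projX u s (f z) - projX u s (f (inY u s y)) := by abel
    rw [e5] at this
    have := norm_sub_le (projX u s (f z)) (projX u s (f (inY u s y)))
    linarith
  -- upper bound
  have g1 := hst z 0 hzr (by simpa using hr)
  rw [hf0, sub_zero, sub_zero] at g1
  have g2 := (projY_le _).trans g1
  have g3 : ‖z‖ ≤ ‖x‖ + ‖y‖ := by
    conv_lhs => rw [hdec]
    refine (norm_add_le _ _).trans ?_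
    rw [norm_inX, norm_inY]
  have g4 : ‖projY u s (D (inX u s x))‖ ≤ B * ‖x‖ :=
    ((projY u s).comp (D.comp (inX u s))).le_of_opNorm_le hfB x
  have g5 : ‖projY u s (D (inY u s y))‖ ≤ μ * ‖y‖ :=
    ((projY u s).comp (D.comp (inY u s))).le_of_opNorm_le hfμ y
  have g6 : projY u s (D z) = projY u s (D (inX u s x)) + projY u s (D (inY u s y)) := by
    conv_lhs => rw [hdec]
    rw [map_add, map_add]
  have upper : ‖projY u s (f z)‖ ≤ (B + ε) * ‖x‖ + (μ + ε) * ‖y‖ := by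
    rw [map_sub] at g2
    have h1 := norm_sub_norm_le (projY u s (f z)) (projY u s (D z))
    have h2 := norm_add_le (projY u s (D (inX u s x))) (projY u s (D (inY u s y)))
    rw [← g6] at h2
    have h3 := mul_le_mul_of_nonneg_left g3 hε.le
    linarith
  set a := (B + ε) * ‖x‖ with ha
  set b := (μ + ε) * ‖y‖ with hb
  have ha0 : 0 ≤ a := by positivity
  have hb0 : 0 ≤ b := by positivity
  have p1 : ‖projY u s (f z)‖ ^ (m + 1) ≤ (a + b) ^ (m + 1) := by gcongr
  have p2 := pow_aux a b ha0 hb0 m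
  have p3 : (a + b) ^ m ≤ (((B + ε) + (μ + ε)) * ε) ^ m := by
    refine pow_le_pow_left₀ (by positivity) ?_ m
    rw [add_mul]
    exact add_le_add (mul_le_mul_of_nonneg_left (by linarith) (by positivity))
      (mul_le_mul_of_nonneg_left (by linarith) (by positivity))
  set Q := (((B + ε) + (μ + ε)) * ε) ^ m with hQ
  have p4 : (m + 1) * a * (a + b) ^ m ≤ (m + 1) * (B + ε) * Q * ‖x‖ := by
    have : (m + 1) * a * (a + b) ^ m ≤ (m + 1) * a * Q := by gcongr
    refine this.trans (le_of_eq ?_)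
    rw [ha]; ring
  have p5 : M * b ^ (m + 1) ≤ (μ + ε) ^ (m + 1) * ‖x‖ := by
    rw [hb, mul_pow]
    have h1 : 0 ≤ (μ + ε) ^ (m + 1) := by positivity
    have h2 := mul_le_mul_of_nonneg_left hcone.le h1
    linarith
  have p6 : K * ‖y‖ ^ (m + 1) ≤ K / M * ‖x‖ := by
    have h1 : ‖y‖ ^ (m + 1) ≤ ‖x‖ / M := by
      rw [le_div_iff₀ hM0]; linarith
    calc K * ‖y‖ ^ (m + 1) ≤ K * (‖x‖ / M) := by gcongr
      _ = _ := by ring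
  have p7 : M * ‖projY u s (f z)‖ ^ (m + 1) ≤
      (μ + ε) ^ (m + 1) * ‖x‖ + M * ((m + 1) * (B + ε) * Q * ‖x‖) := by
    have := mul_le_mul_of_nonneg_left (p1.trans (p2.trans (add_le_add_right p4 _))) hM0.le
    rw [mul_add] at this
    linarith
  have p8 := mul_pos hφ hx0
  linarith
end
end

section
/- Let m ≥ 0 and u, s ≥ 1 be integers. There exists a constant C > 0, depending only on m and s, with the following property: if g : ℝ^u ⊇ dom(g) → ℝ^s is a C^{m+1} map, x₀ ∈ dom(g), δ > 0 with B̄(x₀, δ) ⊆ dom(g), and M > 0 satisfy ‖g(x) − g(x₀) − T_{g,m,x₀}(x − x₀)‖ ≤ M‖x − x₀‖^{m+1} for all x with ‖x − x₀‖ ≤ δ, then for all indices i₁,…,i_{m+1} ∈ {1,…,u}, ‖∂^{m+1}g/(∂x_{i₁}⋯∂x_{i_{m+1}})(x₀)‖ ≤ C·M. -/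
noncomputable section

open Metric Set

theorem aux_clm {E F G : Type*} [NormedAddCommGroup E] [NormedSpace ℝ E] [NormedAddCommGroup F]
    [NormedSpace ℝ F] [NormedAddCommGroup G] [NormedSpace ℝ G] (K : G →L[ℝ] F) (f : E → G)
    (x : E) (h : DifferentiableAt ℝ f x) :
    fderiv ℝ (fun y => K (f y)) x = K.comp (fderiv ℝ f x) :=
  (K.hasFDerivAt.comp x h.hasFDerivAt).fderiv

theorem aux_symm {E F : Type*} [NormedAddCommGroup E] [NormedSpace ℝ E] [NormedAddCommGroup F]
    [NormedSpace ℝ F] (f : E → F) (n : ℕ) : ∀ (x : E), ContDiffAt ℝ n f x →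
    ∀ (σ : Equiv.Perm (Fin n)) (v : Fin n → E),
      iteratedFDeriv ℝ n f x (v ∘ σ) = iteratedFDeriv ℝ n f x v := by
  induction n with
  | zero =>
    intro x _ σ v
    congr 1
    ext i
    exact i.elim0
  | succ n ih =>
    intro x hf σ
    have hσ : σ ∈ Submonoid.closure
        (Set.range fun i : Fin n ↦ Equiv.swap i.castSucc i.succ) := by
      rw [Equiv.Perm.mclosure_swap_castSucc_succ]; trivial
    induction hσ using Submonoid.closure_induction with
    | one => intro v; rfl
    | mul a b _ _ ha hb =>
      intro v
      rw [Equiv.Perm.coe_mul, ← Function.comp_assoc, hb, ha]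
    | mem a ha =>
      obtain ⟨i, rfl⟩ := ha
      intro v
      rcases n with _ | n
      · exact i.elim0
      induction i using Fin.cases with
      | zero =>
        have hs : IsSymmSndFDerivAt ℝ (iteratedFDeriv ℝ n f) x := by
          refine ContDiffAt.isSymmSndFDerivAt (n := 2) ?_ (by simp)
          refine hf.iteratedFDeriv_right ?_
          push_cast
          rw [add_comm (2 : WithTop ℕ∞), add_assoc, one_add_one_eq_two]
        have key : ∀ w : Fin (n + 2) → E, iteratedFDeriv ℝ (n + 1 + 1) f x w =
            fderiv ℝ (fderiv ℝ (iteratedFDeriv ℝ n f)) x (w 0) (w 1) (Fin.tail (Fin.tail w)) := by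
          intro w
          have hd : DifferentiableAt ℝ (fderiv ℝ (iteratedFDeriv ℝ n f)) x := by
            have : ContDiffAt ℝ 2 (iteratedFDeriv ℝ n f) x := by
              refine hf.iteratedFDeriv_right ?_
              push_cast
              rw [add_comm (2 : WithTop ℕ∞), add_assoc, one_add_one_eq_two]
            exact (this.fderiv_right (m := 1) (by norm_num [one_add_one_eq_two])).differentiableAt (by simp)
          have hd' : DifferentiableAt ℝ (iteratedFDeriv ℝ (n + 1) f) x :=
            hf.differentiableAt_iteratedFDeriv (by norm_cast; omega)
          rw [hd'.iteratedFDeriv_succ_apply_left']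
          let K : (E →L[ℝ] ContinuousMultilinearMap ℝ (fun _ : Fin n => E) F) →L[ℝ] F :=
            (ContinuousMultilinearMap.apply ℝ (fun _ : Fin n => E) F (Fin.tail (Fin.tail w))).comp
              (ContinuousLinearMap.apply ℝ _ (w 1))
          have hc := aux_clm (G := E →L[ℝ] ContinuousMultilinearMap ℝ (fun _ : Fin n => E) F) K
            (fderiv ℝ (iteratedFDeriv ℝ n f)) x hd
          exact congrArg (fun T : E →L[ℝ] F => T (w 0)) hc
        rw [key, key, hs.eq]
        refine congrArg _ ?_
        funext j
        simp only [Fin.tail, Function.comp]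
        congr 1
      | succ j =>
        have hd : DifferentiableAt ℝ (iteratedFDeriv ℝ (n + 1) f) x :=
          hf.differentiableAt_iteratedFDeriv (by norm_cast; omega)
        rw [hd.iteratedFDeriv_succ_apply_left', hd.iteratedFDeriv_succ_apply_left']
        have h0 : (v ∘ Equiv.swap j.succ.castSucc j.succ.succ) 0 = v 0 := by
          simp only [Function.comp]
          congr 1
        have ht : Fin.tail (v ∘ Equiv.swap j.succ.castSucc j.succ.succ) =
            Fin.tail v ∘ Equiv.swap j.castSucc j.succ := by
          ext k
          simp only [Function.comp, Fin.tail]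
          congr 1
          rw [← Fin.succ_castSucc]
          exact ((Fin.succ_injective _).map_swap _ _ _).symm
        rw [h0, ht]
        congr 1
        apply Filter.EventuallyEq.fderiv_eq
        have := (hf.of_le (m := ((n + 1 : ℕ) : WithTop ℕ∞)) (by norm_cast; omega)).eventually (by simp)
        filter_upwards [this] with y hy
        exact ih y hy _ _

theorem aux_polar {E F : Type*} [AddCommGroup E] [Module ℝ E] [AddCommGroup F]
    [Module ℝ F] {n : ℕ} (A : MultilinearMap ℝ (fun _ : Fin n => E) F)
    (hA : ∀ (σ : Equiv.Perm (Fin n)) (v : Fin n → E), A (v ∘ σ) = A v) (v : Fin n → E) :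
    ∑ ε : Fin n → Bool, (∏ i, (if ε i then (1 : ℝ) else -1)) •
      A (fun _ => ∑ j, (if ε j then (1 : ℝ) else 0) • v j) = (n.factorial : ℝ) • A v := by
  have h1 : ∀ ε : Fin n → Bool, A (fun _ => ∑ j, (if ε j then (1 : ℝ) else 0) • v j) =
      ∑ r : Fin n → Fin n, (∏ i, (if ε (r i) then (1 : ℝ) else 0)) • A (v ∘ r) := by
    intro ε
    rw [A.map_sum]
    refine Finset.sum_congr rfl fun r _ => ?_
    rw [A.map_smul_univ]
    rfl
  simp_rw [h1, Finset.smul_sum, smul_smul]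
  rw [Finset.sum_comm]
  simp_rw [← Finset.sum_smul]
  have h2 : ∀ r : Fin n → Fin n, (∑ ε : Fin n → Bool, (∏ i, (if ε i then (1 : ℝ) else -1)) *
      (∏ i, (if ε (r i) then (1 : ℝ) else 0))) • A (v ∘ r) =
      if Function.Bijective r then A v else 0 := by
    intro r
    split_ifs with hr
    · have e : A (v ∘ r) = A v := hA (Equiv.ofBijective r hr) v
      rw [e]
      have : ∀ ε : Fin n → Bool, (∏ i, (if ε (r i) then (1 : ℝ) else 0)) =
          ∏ i, (if ε i then (1 : ℝ) else 0) := fun ε =>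
        Equiv.prod_comp (Equiv.ofBijective r hr) (fun i => if ε i then (1 : ℝ) else 0)
      simp_rw [this, ← Finset.prod_mul_distrib]
      have h3 := Finset.prod_univ_sum (fun _ : Fin n => (Finset.univ : Finset Bool))
        (fun _ b => (if b then (1 : ℝ) else -1) * (if b then (1 : ℝ) else 0))
      rw [Fintype.piFinset_univ] at h3
      rw [← h3]
      simp
    · have hs : ¬ Function.Surjective r := fun h => hr (Finite.surjective_iff_bijective.1 h)
      simp only [Function.Surjective, not_forall, not_exists] at hs
      obtain ⟨j, hj⟩ := hs
      rw [Finset.sum_involution (fun ε _ => Function.update ε j (!ε j)), zero_smul]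
      · intro ε _
        have a1 : ∏ i, (if Function.update ε j (!ε j) (r i) then (1 : ℝ) else 0) =
            ∏ i, (if ε (r i) then (1 : ℝ) else 0) := by
          refine Finset.prod_congr rfl fun i _ => ?_
          rw [Function.update_of_ne (hj i)]
        have a2 : ∏ i, (if Function.update ε j (!ε j) i then (1 : ℝ) else -1) =
            - ∏ i, (if ε i then (1 : ℝ) else -1) := by
          rw [← Finset.mul_prod_erase _ _ (Finset.mem_univ j),
            ← Finset.mul_prod_erase _ (fun i => if ε i then (1 : ℝ) else -1) (Finset.mem_univ j)]
          rw [Finset.prod_congr rfl (g := fun i => if ε i then (1 : ℝ) else -1)]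
          · cases h : ε j <;> simp
          · intro i hi
            rw [Function.update_of_ne (Finset.ne_of_mem_erase hi)]
        rw [a1, a2]; ring
      · intro ε _ _ h
        have := congrFun h j
        simp at this
      · simp
      · intro ε _
        simp
  simp_rw [h2]
  rw [← Finset.sum_filter, Finset.sum_const, ← Nat.cast_smul_eq_nsmul ℝ]
  congr 2
  rw [← Fintype.card_subtype]
  rw [← Fintype.card_congr (Equiv.ofBijective (fun σ : Equiv.Perm (Fin n) =>
    (⟨σ, σ.bijective⟩ : {r : Fin n → Fin n // Function.Bijective r})) ⟨?_, ?_⟩)]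
  · rw [Fintype.card_perm, Fintype.card_fin]
  · intro a b h
    simpa using h
  · rintro ⟨r, hr⟩
    exact ⟨Equiv.ofBijective r hr, rfl⟩

theorem aux_diag {E F : Type*} [NormedAddCommGroup E] [NormedSpace ℝ E] [NormedAddCommGroup F]
    [NormedSpace ℝ F] (g : E → F) (m : ℕ) (x₀ : E) (δ M : ℝ) (hδ : 0 < δ)
    (hg : ContDiffOn ℝ (m + 1) g (ball x₀ δ))
    (h : ∀ x, ‖x - x₀‖ ≤ δ →
        ‖g x - g x₀ - ∑ k ∈ Finset.Icc 1 m, (k.factorial : ℝ)⁻¹ •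
            iteratedFDeriv ℝ k g x₀ (fun _ => x - x₀)‖ ≤ M * ‖x - x₀‖ ^ (m + 1)) (w : E) :
    ‖iteratedFDeriv ℝ (m + 1) g x₀ (fun _ => w)‖ ≤ (m + 1).factorial * (M * ‖w‖ ^ (m + 1)) := by
  set f : E → F := fun z => g (x₀ + z) with hf
  set L : ℝ →L[ℝ] E := ContinuousLinearMap.toSpanSingleton ℝ w with hL
  set s : Set ℝ := L ⁻¹' (ball 0 δ) with hs
  have hfs : ContDiffOn ℝ ((m + 1 : ℕ) : WithTop ℕ∞) f (ball 0 δ) := by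
    push_cast
    refine hg.comp (contDiff_const.add contDiff_id).contDiffOn ?_
    intro z hz
    simpa using hz
  have hso : IsOpen s := isOpen_ball.preimage L.continuous
  have h0 : (0 : ℝ) ∈ s := by simp [hs, hδ]
  have hsc : Convex ℝ s := (convex_ball (0 : E) δ).linear_preimage L.toLinearMap
  have hφ : ContDiffOn ℝ ((m + 1 : ℕ) : WithTop ℕ∞) (f ∘ L) s :=
    hfs.comp L.contDiff.contDiffOn (fun _ h => h)
  have hD : ∀ k ≤ m + 1, iteratedDerivWithin k (f ∘ L) s 0 =
      iteratedFDeriv ℝ k g x₀ (fun _ => w) := by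
    intro k hk
    rw [iteratedDerivWithin_eq_iteratedFDerivWithin, hs,
      L.iteratedFDerivWithin_comp_right hfs isOpen_ball.uniqueDiffOn hso.uniqueDiffOn
        (by simpa using hδ) (by exact_mod_cast hk), map_zero,
      iteratedFDerivWithin_of_isOpen k isOpen_ball (by simpa using hδ), hf,
      iteratedFDeriv_comp_add_left, add_zero]
    simp [hL]
  have hT := taylor_tendsto hsc h0 hφ
  rw [hso.nhdsWithin_eq h0] at hT
  have hT' := (hT.mono_left (nhdsWithin_le_nhds (s := {0}ᶜ))).norm.add_const (M * ‖w‖ ^ (m + 1))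
  rw [norm_zero, zero_add] at hT'
  have hmain : ((m + 1).factorial : ℝ)⁻¹ * ‖iteratedFDeriv ℝ (m + 1) g x₀ (fun _ => w)‖ ≤
      M * ‖w‖ ^ (m + 1) := by
    refine ge_of_tendsto hT' ?_
    filter_upwards [self_mem_nhdsWithin, nhdsWithin_le_nhds (hso.mem_nhds h0)] with t ht hts
    have ht0 : t ≠ 0 := ht
    have hb := h (x₀ + t • w) (by
      have : L t ∈ ball (0 : E) δ := hts
      rw [mem_ball_zero_iff] at this
      simpa [hL] using this.le)
    have hexp : (f ∘ L) t - taylorWithinEval (f ∘ L) (m + 1) s 0 t =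
        (g (x₀ + t • w) - g x₀ - ∑ k ∈ Finset.Icc 1 m, (k.factorial : ℝ)⁻¹ •
            iteratedFDeriv ℝ k g x₀ (fun _ => x₀ + t • w - x₀)) -
        t ^ (m + 1) • (((m + 1).factorial : ℝ)⁻¹ •
          iteratedFDeriv ℝ (m + 1) g x₀ (fun _ => w)) := by
      rw [taylor_within_apply, Finset.sum_range_succ, hD _ le_rfl, Finset.sum_range_succ']
      have e1 : ∑ k ∈ Finset.Icc 1 m, (k.factorial : ℝ)⁻¹ •
            iteratedFDeriv ℝ k g x₀ (fun _ => x₀ + t • w - x₀) =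
          ∑ k ∈ Finset.range m, (((k + 1).factorial : ℝ)⁻¹ * (t - 0) ^ (k + 1)) •
            iteratedDerivWithin (k + 1) (f ∘ L) s 0 := by
        rw [Finset.range_eq_Ico, ← Finset.Ico_add_one_right_eq_Icc,
          ← Finset.sum_Ico_add' (fun k => (k.factorial : ℝ)⁻¹ •
            iteratedFDeriv ℝ k g x₀ (fun _ => x₀ + t • w - x₀)) 0 m 1]
        refine Finset.sum_congr rfl fun k hk => ?_
        rw [hD (k + 1) (by have := (Finset.mem_Ico.1 hk).2; omega), add_sub_cancel_left, sub_zero,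
          mul_smul]
        congr 1
        have := (iteratedFDeriv ℝ (k + 1) g x₀).map_smul_univ (fun _ => t) (fun _ => w)
        simpa using this
      rw [e1]
      simp only [iteratedDerivWithin_zero, sub_zero, smul_smul]
      simp [hf, hL, mul_comm (t ^ (m + 1))]
      abel
    rw [add_sub_cancel_left] at hb
    rw [hexp, add_sub_cancel_left, sub_zero]
    rw [norm_smul t w, mul_pow] at hb
    set R := g (x₀ + t • w) - g x₀ - ∑ k ∈ Finset.Icc 1 m, (k.factorial : ℝ)⁻¹ •
            iteratedFDeriv ℝ k g x₀ (fun _ => t • w) with hR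
    set Q := ((m + 1).factorial : ℝ)⁻¹ • iteratedFDeriv ℝ (m + 1) g x₀ (fun _ => w) with hQ
    have hQn : ‖Q‖ = ((m + 1).factorial : ℝ)⁻¹ * ‖iteratedFDeriv ℝ (m + 1) g x₀ (fun _ => w)‖ := by
      rw [hQ, norm_smul, Real.norm_of_nonneg (by positivity)]
    rw [← hQn]
    have htp : t ^ (m + 1) ≠ 0 := pow_ne_zero _ ht0
    have hQ2 : Q = (t ^ (m + 1))⁻¹ • R - (t ^ (m + 1))⁻¹ • (R - t ^ (m + 1) • Q) := by
      clear_value Q R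
      rw [smul_sub, smul_smul, inv_mul_cancel₀ htp, one_smul]; abel
    have hRn : ‖(t ^ (m + 1))⁻¹ • R‖ ≤ M * ‖w‖ ^ (m + 1) := by
      rw [norm_smul, norm_inv, norm_pow, inv_mul_le_iff₀ (by positivity)]
      linarith
    calc ‖Q‖ = ‖(t ^ (m + 1))⁻¹ • R - (t ^ (m + 1))⁻¹ • (R - t ^ (m + 1) • Q)‖ :=
          congrArg norm hQ2
      _ ≤ _ := norm_sub_le _ _
      _ ≤ _ := by linarith
  rwa [inv_mul_le_iff₀ (by positivity)] at hmain

/-- Lemma 4.3 (cone conditions bound the top derivative): there is a constant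
`C = C(m,s) > 0` such that whenever a `C^{m+1}` map `g` satisfies the order-`m`
Taylor remainder bound `‖g(x) − g(x₀) − T_{g,m,x₀}(x−x₀)‖ ≤ M‖x−x₀‖^{m+1}` on a
closed ball `B̄(x₀,δ)` contained in its domain, all mixed partial derivatives of
order `m+1` of `g` at `x₀` are bounded in norm by `C·M`. -/
theorem stmt6 (m s : ℕ) (hs : 0 < s) :
    ∃ C : ℝ, 0 < C ∧
      ∀ (u : ℕ), 0 < u →
      ∀ (dom : Set (Evec u)) (g : Evec u → Evec s), ContDiffOn ℝ (m + 1) g dom →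
      ∀ x₀ ∈ dom, ∀ δ : ℝ, 0 < δ → closedBall x₀ δ ⊆ dom →
      ∀ M : ℝ, 0 < M →
      (∀ x, ‖x - x₀‖ ≤ δ →
        ‖g x - g x₀ - ∑ k ∈ Finset.Icc 1 m, (k.factorial : ℝ)⁻¹ •
            iteratedFDeriv ℝ k g x₀ (fun _ => x - x₀)‖ ≤ M * ‖x - x₀‖ ^ (m + 1)) →
      ∀ i : Fin (m + 1) → Fin u,
        ‖iteratedFDeriv ℝ (m + 1) g x₀
            (fun j => EuclideanSpace.single (i j) (1 : ℝ))‖ ≤ C * M := by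
  refine ⟨2 ^ (m + 1) * (m + 1 : ℝ) ^ (m + 1), by positivity, ?_⟩
  intro u _ dom g hg x₀ _ δ hδ hdom M hM h i
  have hg' : ContDiffOn ℝ (m + 1) g (ball x₀ δ) := hg.mono (ball_subset_closedBall.trans hdom)
  have hat : ContDiffAt ℝ ((m + 1 : ℕ) : WithTop ℕ∞) g x₀ := by
    push_cast
    exact hg'.contDiffAt (ball_mem_nhds _ hδ)
  set v : Fin (m + 1) → Evec u := fun j => EuclideanSpace.single (i j) (1 : ℝ) with hv
  have hp := aux_polar (iteratedFDeriv ℝ (m + 1) g x₀).toMultilinearMap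
    (fun σ v => aux_symm g (m + 1) x₀ hat σ v) v
  simp only [ContinuousMultilinearMap.coe_coe] at hp
  have hfac : (0 : ℝ) < (m + 1).factorial := by positivity
  have hb : ‖((m + 1).factorial : ℝ) • iteratedFDeriv ℝ (m + 1) g x₀ v‖ ≤
      ∑ ε : Fin (m + 1) → Bool, ((m + 1).factorial : ℝ) * (M * (m + 1 : ℝ) ^ (m + 1)) := by
    rw [← hp]
    refine norm_sum_le_of_le _ fun ε _ => ?_
    have h1 : ‖∏ i, (if ε i then (1 : ℝ) else -1)‖ = 1 := by
      rw [norm_prod]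
      refine Finset.prod_eq_one fun i _ => ?_
      split_ifs <;> simp
    rw [norm_smul, h1, one_mul]
    refine (aux_diag g m x₀ δ M hδ hg' h _).trans ?_
    have hw : ‖∑ j, (if ε j then (1 : ℝ) else 0) • v j‖ ≤ (m + 1 : ℝ) := by
      refine (norm_sum_le_of_le (f := fun j => (if ε j then (1 : ℝ) else 0) • v j) _
        (n := fun _ => (1 : ℝ)) fun j _ => ?_).trans ?_
      · split_ifs <;> simp [hv]
      · simp
    gcongr
  rw [norm_smul, Real.norm_of_nonneg hfac.le, Finset.sum_const, Finset.card_univ] at hb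
  simp only [Fintype.card_pi, Fintype.card_bool, Finset.prod_const, Finset.card_univ,
    Fintype.card_fin, nsmul_eq_mul] at hb
  push_cast at hb
  refine le_of_mul_le_mul_left (hb.trans (le_of_eq ?_)) hfac
  ring
end
end

section
/- Fix integers u, s ≥ 1, an integer m ≥ 1, and reals c, d > 0. There exists C > 0, depending only on u, s, m, c, d, such that the following holds. Let U ⊆ ℝ^u × ℝ^s be a convex bounded neighborhood of 0 with diameter at most d, and let f : U → ℝ^s be a C^{m+1} map with f(0) = 0, all of whose derivatives of order ≤ m+1 are bounded in norm by c on U, and whose pure-x derivatives at 0 vanish up to order m: for 1 ≤ j ≤ m, D^j f(0)(h₁,…,h_j) = 0 whenever h₁,…,h_j ∈ ℝ^u × {0}. Then for all (x, y) ∈ U: ‖f(x,y) − (∂f/∂y)(0)(y)‖ ≤ C·( ‖y‖² + ‖x‖·‖y‖ + ‖x‖^{m+1} ), where ∂f/∂y(0) : ℝ^s → ℝ^s is the linear map w ↦ Df(0)(0, w). -/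
noncomputable section

open Metric Set

theorem ray_taylor {E F : Type*} [NormedAddCommGroup E] [NormedSpace ℝ E]
    [NormedAddCommGroup F] [NormedSpace ℝ F] (m : ℕ) (c : ℝ) (hc : 0 < c)
    (U : Set E) (hU : Convex ℝ U) (h0 : U ∈ nhds (0 : E)) (f : E → F)
    (hf : ContDiffOn ℝ (m + 1) f U)
    (hb : ∀ z ∈ U, ∀ k ≤ m + 1, ‖iteratedFDerivWithin ℝ k f U z‖ ≤ c)
    (z : E) (hz : z ∈ U) :
    ‖f z - ∑ k ∈ Finset.range (m + 1),
      ((k.factorial : ℝ)⁻¹) • iteratedFDeriv ℝ k f 0 (fun _ => z)‖ ≤ c * ‖z‖ ^ (m + 1) := by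
  have hUD : UniqueDiffOn ℝ U := uniqueDiffOn_convex hU ⟨0, mem_interior_iff_mem_nhds.2 h0⟩
  have hI : UniqueDiffOn ℝ (Icc (0:ℝ) 1) := uniqueDiffOn_Icc zero_lt_one
  let L : ℝ →L[ℝ] E := (ContinuousLinearMap.id ℝ ℝ).smulRight z
  have hL : ∀ t, L t = t • z := fun t => by simp [L]
  have h00 : (0 : E) ∈ U := mem_of_mem_nhds h0
  have hsub : Icc (0:ℝ) 1 ⊆ L ⁻¹' U := by
    intro t ht
    rw [mem_preimage, hL]
    exact hU.smul_mem_of_zero_mem h00 hz ht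
  have hT := ((hf.ftaylorSeriesWithin hUD).compContinuousLinearMap L).mono hsub
  have key : ∀ k ≤ m + 1, ∀ t ∈ Icc (0:ℝ) 1, iteratedDerivWithin k (f ∘ L) (Icc 0 1) t
      = iteratedFDerivWithin ℝ k f U (t • z) (fun _ => z) := by
    intro k hk t ht
    have := hT.eq_iteratedFDerivWithin_of_uniqueDiffOn (m := k) (by exact_mod_cast hk) hI ht
    rw [iteratedDerivWithin_eq_iteratedFDerivWithin, ← this]
    simp [ftaylorSeriesWithin, hL]
  have hg : ContDiffOn ℝ (m + 1) (f ∘ L) (Icc 0 1) :=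
    hf.comp L.contDiff.contDiffOn hsub
  have hbd := taylor_mean_remainder_bound (f := f ∘ L) (a := 0) (b := 1) (x := 1) (n := m)
    (C := c * ‖z‖ ^ (m+1)) zero_le_one hg (by simp) (by
      intro t ht
      rw [key _ le_rfl t ht]
      have h1 := (iteratedFDerivWithin ℝ (m+1) f U (t • z)).le_opNorm (fun _ => z)
      simp only [Finset.prod_const, Finset.card_univ, Fintype.card_fin] at h1
      refine h1.trans ?_
      gcongr
      exact hb _ (hU.smul_mem_of_zero_mem h00 hz ht) _ le_rfl)
  rw [taylor_within_apply] at hbd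
  have e : ∀ k ∈ Finset.range (m+1), ((k.factorial : ℝ)⁻¹ * (1 - 0) ^ k) •
      iteratedDerivWithin k (f ∘ L) (Icc 0 1) 0
      = ((k.factorial : ℝ)⁻¹) • iteratedFDeriv ℝ k f 0 (fun _ => z) := by
    intro k hk
    have hk' : k ≤ m + 1 := (Finset.mem_range.1 hk).le
    rw [key k hk' 0 (by simp), zero_smul, iteratedFDerivWithin_eq_iteratedFDeriv hUD _ h00]
    · simp
    · exact (hf.contDiffAt h0).of_le (by exact_mod_cast hk')
  rw [Finset.sum_congr rfl e] at hbd
  simp only [Function.comp, hL, one_smul, sub_zero, one_pow, mul_one] at hbd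
  refine hbd.trans (div_le_self (by positivity) ?_)
  exact_mod_cast Nat.factorial_pos m

theorem abs_est {E F : Type*} [NormedAddCommGroup E] [NormedSpace ℝ E]
    [NormedAddCommGroup F] [NormedSpace ℝ F] (m : ℕ) (hm : 1 ≤ m) (c D : ℝ) (hc : 0 < c)
    (hD : 1 ≤ D)
    (U : Set E) (hU : Convex ℝ U) (h0 : U ∈ nhds (0 : E)) (f : E → F)
    (hf : ContDiffOn ℝ (m + 1) f U) (hf0 : f 0 = 0)
    (hb : ∀ z ∈ U, ∀ k ≤ m + 1, ‖iteratedFDerivWithin ℝ k f U z‖ ≤ c)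
    (p q z : E) (hz : z ∈ U) (hpq : z = p + q) (hzD : ‖z‖ ≤ D) (hpz : ‖p‖ ≤ ‖z‖)
    (hp : ∀ j : ℕ, 1 ≤ j → j ≤ m → iteratedFDeriv ℝ j f 0 (fun _ => p) = 0) :
    ‖f z - fderiv ℝ f 0 q‖ ≤
      c * ‖z‖ ^ (m + 1) + (m + 1) * (c * m * D ^ m * (‖z‖ * ‖q‖)) := by
  have hUD : UniqueDiffOn ℝ U := uniqueDiffOn_convex hU ⟨0, mem_interior_iff_mem_nhds.2 h0⟩
  have h1 := ray_taylor m c hc U hU h0 f hf hb z hz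
  set a : ℕ → F := fun k => ((k.factorial : ℝ)⁻¹) • iteratedFDeriv ℝ k f 0 (fun _ => z) with ha
  have h2 : ∀ k ∈ Finset.range (m+1), ‖a k - if k = 1 then fderiv ℝ f 0 q else 0‖
      ≤ c * m * D ^ m * (‖z‖ * ‖q‖) := by
    intro k hk
    have hk' : k ≤ m := Nat.lt_succ_iff.1 (Finset.mem_range.1 hk)
    have hnn : 0 ≤ c * m * D ^ m * (‖z‖ * ‖q‖) := by positivity
    match k, hk' with
    | 0, _ => simpa [ha, hf0] using hnn
    | 1, _ =>
      have h3 := hp 1 le_rfl hm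
      rw [iteratedFDeriv_one_apply] at h3
      have h4 : a 1 = fderiv ℝ f 0 q := by
        simp only [ha]
        rw [iteratedFDeriv_one_apply, hpq, map_add, h3]
        simp
      simpa [h4] using hnn
    | i + 2, hk' =>
      have hne : i + 2 ≠ 1 := by omega
      rw [if_neg hne, sub_zero]
      have h3 := (iteratedFDeriv ℝ (i+2) f 0).norm_image_sub_le (fun _ => z) (fun _ => p)
      rw [hp _ (by omega) hk', sub_zero] at h3
      have h5 : ((fun _ => z) - (fun _ => p) : Fin (i+2) → E) = fun _ => q := by
        ext; simp [hpq]
      rw [h5, pi_norm_const, pi_norm_const, pi_norm_const, max_eq_left hpz] at h3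
      simp only [Fintype.card_fin] at h3
      have h6 : ‖iteratedFDeriv ℝ (i+2) f 0‖ ≤ c := by
        rw [← iteratedFDerivWithin_eq_iteratedFDeriv hUD _ (mem_of_mem_nhds h0)]
        · exact hb 0 (mem_of_mem_nhds h0) _ (by omega)
        · exact (hf.contDiffAt h0).of_le (by exact_mod_cast (by omega : i + 2 ≤ m + 1))
      have h7 : ‖z‖ ^ i ≤ D ^ m := (pow_le_pow_left₀ (norm_nonneg _) hzD i).trans
        (pow_le_pow_right₀ hD (by omega))
      have h8 : ((i + 2 : ℕ) : ℝ) ≤ m := by exact_mod_cast hk'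
      have h9 : (((i+2).factorial : ℝ)⁻¹) ≤ 1 :=
        inv_le_one_of_one_le₀ (by exact_mod_cast Nat.factorial_pos _)
      calc ‖a (i+2)‖ ≤ 1 * ‖iteratedFDeriv ℝ (i+2) f 0 (fun _ => z)‖ := by
            simp only [ha]
            rw [norm_smul, Real.norm_of_nonneg (by positivity)]
            gcongr
        _ ≤ ‖iteratedFDeriv ℝ (i+2) f 0‖ * ((i+2 : ℕ):ℝ) * ‖z‖ ^ (i+2-1) * ‖q‖ := by
            rw [one_mul]; exact h3
        _ = ‖iteratedFDeriv ℝ (i+2) f 0‖ * ((i+2 : ℕ):ℝ) * ‖z‖ ^ i * (‖z‖ * ‖q‖) := by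
            rw [show i + 2 - 1 = i + 1 by omega, pow_succ]; ring
        _ ≤ _ := by gcongr
  have h3 : ∑ k ∈ Finset.range (m+1), (if k = 1 then fderiv ℝ f 0 q else 0)
      = fderiv ℝ f 0 q := by
    rw [Finset.sum_ite_eq', if_pos (Finset.mem_range.2 (by omega))]
  have h4 : f z - fderiv ℝ f 0 q = (f z - ∑ k ∈ Finset.range (m+1), a k) +
      ∑ k ∈ Finset.range (m+1), (a k - if k = 1 then fderiv ℝ f 0 q else 0) := by
    rw [Finset.sum_sub_distrib, h3]; abel
  rw [h4]
  refine (norm_add_le _ _).trans (add_le_add h1 ?_)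
  refine (norm_sum_le_of_le _ h2).trans ?_
  simp

/-- Lemma A.1 (auxiliary Taylor estimate): there is `C = C(u,s,m,c,d) > 0` such
that if `f : ℝ^u × ℝ^s → ℝ^s` is `C^{m+1}` on a convex bounded neighborhood `U`
of `0` of diameter `≤ d`, with `f(0) = 0`, all derivatives of order `≤ m+1`
bounded by `c`, and vanishing pure-`x` derivatives at `0` up to order `m`, then
for all `(x,y) ∈ U`, `‖f(x,y) − (∂f/∂y)(0)(y)‖ ≤ C(‖y‖² + ‖x‖‖y‖ + ‖x‖^{m+1})`. -/
theorem stmt8 (u s : ℕ) (hu : 0 < u) (hs : 0 < s) (m : ℕ) (hm : 1 ≤ m)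
    (c d : ℝ) (hc : 0 < c) (hd : 0 < d) :
    ∃ C : ℝ, 0 < C ∧
      ∀ (U : Set (EF u s)), Convex ℝ U → Bornology.IsBounded U →
        U ∈ nhds (0 : EF u s) → Metric.diam U ≤ d →
      ∀ f : EF u s → Evec s, ContDiffOn ℝ (m + 1) f U → f 0 = 0 →
      (∀ z ∈ U, ∀ k ≤ m + 1, ‖iteratedFDerivWithin ℝ k f U z‖ ≤ c) →
      (∀ j : ℕ, 1 ≤ j → j ≤ m → ∀ h : Fin j → Evec u,
        iteratedFDeriv ℝ j f 0 (fun i => inX u s (h i)) = 0) →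
      ∀ z ∈ U, ‖f z - fderiv ℝ f 0 (inY u s (projY u s z))‖
        ≤ C * (‖projY u s z‖ ^ 2 + ‖projX u s z‖ * ‖projY u s z‖
            + ‖projX u s z‖ ^ (m + 1)) := by
  set D : ℝ := 1 + d with hDdef
  have hD : 1 ≤ D := by linarith
  refine ⟨c * 2 ^ m * D ^ m + (m + 1) * (c * m * D ^ m), by positivity, ?_⟩
  intro U hU hbd h0 hdiam f hf hf0 hb hp z hz
  have hsum : z = inX u s (projX u s z) + inY u s (projY u s z) := by
    apply (WithLp.prodContinuousLinearEquiv 2 ℝ (Evec u) (Evec s)).injective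
    simp [inX, inY, projX, projY]
    rfl
  have hnx : ‖inX u s (projX u s z)‖ = ‖projX u s z‖ := by
    simp [inX]
  have hny : ‖inY u s (projY u s z)‖ = ‖projY u s z‖ := by
    simp [inY]
  have hsq : ‖z‖ ^ 2 = ‖projX u s z‖ ^ 2 + ‖projY u s z‖ ^ 2 :=
    WithLp.prod_norm_sq_eq_of_L2 z
  have hxz : ‖projX u s z‖ ≤ ‖z‖ :=
    le_of_sq_le_sq (by nlinarith [sq_nonneg ‖projY u s z‖]) (norm_nonneg _)
  have hyz : ‖projY u s z‖ ≤ ‖z‖ :=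
    le_of_sq_le_sq (by nlinarith [sq_nonneg ‖projX u s z‖]) (norm_nonneg _)
  have hzD : ‖z‖ ≤ D := by
    have := dist_le_diam_of_mem hbd hz (mem_of_mem_nhds h0)
    rw [dist_zero_right] at this
    linarith
  have hmain := abs_est m hm c D hc hD U hU h0 f hf hf0 hb (inX u s (projX u s z))
    (inY u s (projY u s z)) z hz hsum hzD (hnx.trans_le hxz)
    (fun j h1 h2 => hp j h1 h2 (fun _ => projX u s z))
  have htri : ‖z‖ ≤ ‖projX u s z‖ + ‖projY u s z‖ := by
    calc ‖z‖ = ‖inX u s (projX u s z) + inY u s (projY u s z)‖ := by rw [← hsum]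
      _ ≤ _ := (norm_add_le _ _).trans_eq (by rw [hnx, hny])
  rw [hny] at hmain
  have hx0 := norm_nonneg (projX u s z)
  have hy0 := norm_nonneg (projY u s z)
  have hz0 := norm_nonneg z
  refine hmain.trans ?_
  clear hmain
  generalize ‖projX u s z‖ = a at *
  generalize ‖projY u s z‖ = b at *
  generalize ‖z‖ = r at *
  have hr : r * b ≤ b ^ 2 + a * b + a ^ (m+1) := by
    have := mul_le_mul_of_nonneg_right htri hy0
    have : 0 ≤ a ^ (m+1) := by positivity
    nlinarith
  have hbm : b ^ (m+1) ≤ D ^ m * b ^ 2 := by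
    obtain ⟨k, rfl⟩ : ∃ k, m = k + 1 := ⟨m - 1, by omega⟩
    have : b ^ k ≤ D ^ (k+1) := (pow_le_pow_left₀ hy0 (hyz.trans hzD) k).trans
      (pow_le_pow_right₀ hD (by omega))
    calc b ^ (k+1+1) = b ^ k * b ^ 2 := by ring
      _ ≤ _ := by gcongr
  have hDm : 1 ≤ D ^ m := one_le_pow₀ hD
  have hrm : r ^ (m+1) ≤ 2 ^ m * D ^ m * (b ^ 2 + a * b + a ^ (m+1)) := by
    calc r ^ (m+1) ≤ (a + b) ^ (m+1) := by gcongr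
      _ ≤ 2 ^ (m+1-1) * (a ^ (m+1) + b ^ (m+1)) := add_pow_le hx0 hy0 _
      _ ≤ 2 ^ m * (D ^ m * a ^ (m+1) + D ^ m * b ^ 2) := by
          rw [Nat.add_sub_cancel]
          gcongr
          exact le_mul_of_one_le_left (by positivity) hDm
      _ = 2 ^ m * D ^ m * (b ^ 2 + 0 + a ^ (m+1)) := by ring
      _ ≤ _ := by gcongr; positivity
  calc _ ≤ c * (2 ^ m * D ^ m * (b ^ 2 + a * b + a ^ (m+1)))
        + (m + 1) * (c * m * D ^ m * (b ^ 2 + a * b + a ^ (m+1))) := by gcongr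
    _ = _ := by ring
end
end

section
/- Let 0 < L < 1. Let w^{cs} : ℝ^c × ℝ^s → ℝ^u and w^{cu} : ℝ^c × ℝ^u → ℝ^s and points (λ*, x*, y*) ∈ ℝ^c × ℝ^u × ℝ^s be such that x* = w^{cs}(λ*, y*), y* = w^{cu}(λ*, x*), the map w^{cs} is differentiable at (λ*, y*) with ‖Dw^{cs}(λ*, y*)‖ ≤ L, and w^{cu} is differentiable at (λ*, x*) with ‖Dw^{cu}(λ*, x*)‖ ≤ L. Define φ_{cu}(λ, x) = (λ, x, w^{cu}(λ, x)) and φ_{cs}(λ, y) = (λ, w^{cs}(λ, y), y). Then the graphs of w^{cu} and w^{cs} intersect transversally at p* = (λ*, x*, y*): the ranges of the derivatives Dφ_{cu}(λ*, x*) : ℝ^c × ℝ^u → ℝ^c × ℝ^u × ℝ^s and Dφ_{cs}(λ*, y*) : ℝ^c × ℝ^s → ℝ^c × ℝ^u × ℝ^s together span all of ℝ^c × ℝ^u × ℝ^s. -/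
noncomputable section

open Metric Set

/-- The Euclidean (ℓ²) product of two normed spaces. -/
abbrev P2 (α β : Type*) : Type _ := WithLp 2 (α × β)

/-- `ℝ^c × ℝ^u × ℝ^s` with the Euclidean norm. -/
abbrev E3 (c u s : ℕ) : Type := P2 (Evec c) (P2 (Evec u) (Evec s))

/-- Build a point of `ℝ^c × ℝ^u × ℝ^s`. -/
def mk3 (c u s : ℕ) (a : Evec c) (b : Evec u) (d : Evec s) : E3 c u s :=
  (WithLp.equiv 2 (Evec c × P2 (Evec u) (Evec s))).symm
    (a, (WithLp.equiv 2 (Evec u × Evec s)).symm (b, d))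

theorem aux_surj {c u s : ℕ} (L : ℝ) (hL0 : 0 < L) (hL1 : L < 1)
    (B : P2 (Evec c) (Evec s) →L[ℝ] Evec u) (A : P2 (Evec c) (Evec u) →L[ℝ] Evec s)
    (hB : ‖B‖ ≤ L) (hA : ‖A‖ ≤ L) (a : Evec c) (b : Evec u) (d : Evec s) :
    ∃ (x : Evec u) (y : Evec s), x + B (WithLp.toLp 2 (0, y)) = b ∧
      A (WithLp.toLp 2 (a, x)) + y = d := by
  let iu : Evec u →ₗ[ℝ] P2 (Evec c) (Evec u) :=
    (WithLp.linearEquiv 2 ℝ (Evec c × Evec u)).symm.toLinearMap ∘ₗ LinearMap.inr ℝ _ _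
  let is' : Evec s →ₗ[ℝ] P2 (Evec c) (Evec s) :=
    (WithLp.linearEquiv 2 ℝ (Evec c × Evec s)).symm.toLinearMap ∘ₗ LinearMap.inr ℝ _ _
  have nu : ∀ x, ‖iu x‖ = ‖x‖ := fun x => by
    change ‖WithLp.toLp 2 ((0 : Evec c), x)‖ = _
    simp
  have ns : ∀ x, ‖is' x‖ = ‖x‖ := fun x => by
    change ‖WithLp.toLp 2 ((0 : Evec c), x)‖ = _
    simp
  let T : Evec u →ₗ[ℝ] Evec u :=
    LinearMap.id - (B.toLinearMap ∘ₗ is' ∘ₗ A.toLinearMap ∘ₗ iu)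
  have hT : ∀ x, T x = x - B (is' (A (iu x))) := fun x => rfl
  have hinj : Function.Injective T := by
    rw [injective_iff_map_eq_zero]
    intro x hx
    rw [hT, sub_eq_zero] at hx
    have h1 : ‖B (is' (A (iu x)))‖ ≤ L * ‖A (iu x)‖ := by
      have := B.le_of_opNorm_le hB (is' (A (iu x)))
      rwa [ns] at this
    have h2 : ‖A (iu x)‖ ≤ L * ‖x‖ := by
      have := A.le_of_opNorm_le hA (iu x)
      rwa [nu] at this
    rw [← hx] at h1
    have h3 : ‖x‖ ≤ 0 := by
      have hn := norm_nonneg x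
      have : ‖x‖ ≤ L * (L * ‖x‖) := h1.trans (by gcongr)
      by_contra h
      push Not at h
      nlinarith [mul_pos hL0 h]
    exact norm_le_zero_iff.1 h3
  obtain ⟨x, hx⟩ := LinearMap.injective_iff_surjective.1 hinj
    (b - B (is' (d - A (WithLp.toLp 2 (a, 0)))))
  refine ⟨x, d - A (WithLp.toLp 2 (a, x)), ?_, by abel⟩
  have e1 : WithLp.toLp 2 (a, x) = WithLp.toLp 2 (a, (0 : Evec u)) + iu x := by
    change _ = WithLp.toLp 2 (a, (0 : Evec u)) + WithLp.toLp 2 ((0 : Evec c), x)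
    rw [← WithLp.toLp_add]; simp
  change x + B (is' (d - A (WithLp.toLp 2 (a, x)))) = b
  rw [hT] at hx
  rw [e1, map_add, ← sub_sub, map_sub is', map_sub B]
  rw [sub_eq_iff_eq_add] at hx
  nth_rewrite 1 [hx]
  abel

theorem mk3_add {c u s : ℕ} (a a' : Evec c) (b b' : Evec u) (d d' : Evec s) :
    mk3 c u s a b d + mk3 c u s a' b' d' = mk3 c u s (a + a') (b + b') (d + d') := rfl

theorem aux_gen {V X Y Z : Type*} [NormedAddCommGroup V] [NormedSpace ℝ V]
    [NormedAddCommGroup X] [NormedSpace ℝ X] [NormedAddCommGroup Y] [NormedSpace ℝ Y]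
    [NormedAddCommGroup Z] [NormedSpace ℝ Z] (f : V → X) (g : V → Y) (h : V → Z) (p q : V)
    (f' : V →L[ℝ] X) (g' : V →L[ℝ] Y) (h' : V →L[ℝ] Z)
    (hf : HasFDerivAt f f' p) (hg : HasFDerivAt g g' p) (hh : HasFDerivAt h h' p) :
    fderiv ℝ (fun p => WithLp.toLp 2 (f p, WithLp.toLp 2 (g p, h p))) p q
      = WithLp.toLp 2 (f' q, WithLp.toLp 2 (g' q, h' q)) := by
  let F := (WithLp.prodContinuousLinearEquiv 2 ℝ X (P2 Y Z)).symm
  let G := (WithLp.prodContinuousLinearEquiv 2 ℝ Y Z).symm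
  have h1 : HasFDerivAt (fun p => WithLp.toLp 2 (g p, h p))
      (G.toContinuousLinearMap.comp (g'.prod h')) p :=
    G.hasFDerivAt.comp p (hg.prodMk hh)
  have h2 : HasFDerivAt (fun p => WithLp.toLp 2 (f p, WithLp.toLp 2 (g p, h p)))
      (F.toContinuousLinearMap.comp (f'.prod (G.toContinuousLinearMap.comp (g'.prod h')))) p :=
    F.hasFDerivAt.comp p (hf.prodMk h1)
  rw [h2.fderiv]
  rfl

theorem aux_fst {X Y : Type*} [NormedAddCommGroup X] [NormedSpace ℝ X]
    [NormedAddCommGroup Y] [NormedSpace ℝ Y] (p : P2 X Y) :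
    HasFDerivAt (fun p : P2 X Y => p.fst) ((ContinuousLinearMap.fst ℝ X Y).comp
      (WithLp.prodContinuousLinearEquiv 2 ℝ X Y).toContinuousLinearMap) p :=
  ((ContinuousLinearMap.fst ℝ X Y).comp
    (WithLp.prodContinuousLinearEquiv 2 ℝ X Y).toContinuousLinearMap).hasFDerivAt

theorem aux_snd {X Y : Type*} [NormedAddCommGroup X] [NormedSpace ℝ X]
    [NormedAddCommGroup Y] [NormedSpace ℝ Y] (p : P2 X Y) :
    HasFDerivAt (fun p : P2 X Y => p.snd) ((ContinuousLinearMap.snd ℝ X Y).comp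
      (WithLp.prodContinuousLinearEquiv 2 ℝ X Y).toContinuousLinearMap) p :=
  ((ContinuousLinearMap.snd ℝ X Y).comp
    (WithLp.prodContinuousLinearEquiv 2 ℝ X Y).toContinuousLinearMap).hasFDerivAt

theorem aux_fderiv_cu {c u s : ℕ} (w : P2 (Evec c) (Evec u) → Evec s) (p q : P2 (Evec c) (Evec u))
    (h : DifferentiableAt ℝ w p) :
    fderiv ℝ (fun p : P2 (Evec c) (Evec u) =>
              mk3 c u s ((WithLp.equiv 2 (Evec c × Evec u)) p).1
                ((WithLp.equiv 2 (Evec c × Evec u)) p).2 (w p)) p q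
      = mk3 c u s q.fst q.snd (fderiv ℝ w p q) :=
  aux_gen _ _ _ p q _ _ _ (aux_fst p) (aux_snd p) h.hasFDerivAt

theorem aux_fderiv_cs {c u s : ℕ} (w : P2 (Evec c) (Evec s) → Evec u) (p q : P2 (Evec c) (Evec s))
    (h : DifferentiableAt ℝ w p) :
    fderiv ℝ (fun p : P2 (Evec c) (Evec s) =>
              mk3 c u s ((WithLp.equiv 2 (Evec c × Evec s)) p).1 (w p)
                ((WithLp.equiv 2 (Evec c × Evec s)) p).2) p q
      = mk3 c u s q.fst (fderiv ℝ w p q) q.snd :=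
  aux_gen _ _ _ p q _ _ _ (aux_fst p) h.hasFDerivAt (aux_snd p)

/-- Lemma 6.2 (transversality of `W^{cu}` and `W^{cs}` at an intersection
point): if `x* = w^{cs}(λ*,y*)`, `y* = w^{cu}(λ*,x*)`, and `w^{cs}`, `w^{cu}`
are differentiable at the respective points with derivative norms `≤ L < 1`,
then the ranges of the derivatives of the graph parameterizations
`φ_{cu}(λ,x) = (λ,x,w^{cu}(λ,x))` and `φ_{cs}(λ,y) = (λ,w^{cs}(λ,y),y)`
together span `ℝ^c × ℝ^u × ℝ^s`. -/
theorem stmt18 (c u s : ℕ) (hc : 0 < c) (hu : 0 < u) (hs : 0 < s)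
    (L : ℝ) (hL0 : 0 < L) (hL1 : L < 1)
    (wcs : P2 (Evec c) (Evec s) → Evec u) (wcu : P2 (Evec c) (Evec u) → Evec s)
    (lam : Evec c) (xstar : Evec u) (ystar : Evec s)
    (hx : xstar = wcs ((WithLp.equiv 2 (Evec c × Evec s)).symm (lam, ystar)))
    (hy : ystar = wcu ((WithLp.equiv 2 (Evec c × Evec u)).symm (lam, xstar)))
    (hwcs_diff : DifferentiableAt ℝ wcs
      ((WithLp.equiv 2 (Evec c × Evec s)).symm (lam, ystar)))
    (hwcs_lip : ‖fderiv ℝ wcs ((WithLp.equiv 2 (Evec c × Evec s)).symm (lam, ystar))‖ ≤ L)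
    (hwcu_diff : DifferentiableAt ℝ wcu
      ((WithLp.equiv 2 (Evec c × Evec u)).symm (lam, xstar)))
    (hwcu_lip : ‖fderiv ℝ wcu ((WithLp.equiv 2 (Evec c × Evec u)).symm (lam, xstar))‖ ≤ L) :
    Submodule.span ℝ
        (Set.range (fderiv ℝ
            (fun p : P2 (Evec c) (Evec u) =>
              mk3 c u s ((WithLp.equiv 2 (Evec c × Evec u)) p).1
                ((WithLp.equiv 2 (Evec c × Evec u)) p).2 (wcu p))
            ((WithLp.equiv 2 (Evec c × Evec u)).symm (lam, xstar))) ∪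
          Set.range (fderiv ℝ
            (fun p : P2 (Evec c) (Evec s) =>
              mk3 c u s ((WithLp.equiv 2 (Evec c × Evec s)) p).1 (wcs p)
                ((WithLp.equiv 2 (Evec c × Evec s)) p).2)
            ((WithLp.equiv 2 (Evec c × Evec s)).symm (lam, ystar))))
      = (⊤ : Submodule ℝ (E3 c u s)) := by
  rw [eq_top_iff]
  intro v _
  obtain ⟨x, y, h1, h2⟩ := aux_surj L hL0 hL1 _ _ hwcs_lip hwcu_lip v.fst v.snd.fst v.snd.snd
  have hv : v = mk3 c u s v.fst x
        (fderiv ℝ wcu ((WithLp.equiv 2 (Evec c × Evec u)).symm (lam, xstar))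
          (WithLp.toLp 2 (v.fst, x))) +
      mk3 c u s 0 (fderiv ℝ wcs ((WithLp.equiv 2 (Evec c × Evec s)).symm (lam, ystar))
          (WithLp.toLp 2 (0, y))) y := by
    rw [mk3_add, h1, h2, add_zero]
    rfl
  rw [hv]
  refine Submodule.add_mem _ (Submodule.subset_span (Or.inl ⟨WithLp.toLp 2 (v.fst, x), ?_⟩))
    (Submodule.subset_span (Or.inr ⟨WithLp.toLp 2 (0, y), ?_⟩))
  · exact aux_fderiv_cu wcu _ _ hwcu_diff
  · exact aux_fderiv_cs wcs _ _ hwcs_diff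
end
end

section
/- Let 0 < L < 1 and let λ ∈ ℝ^c, x ∈ ℝ^u, y ∈ ℝ^s. If ‖y‖ ≤ L·‖(λ, x)‖ and ‖x‖ ≤ L·‖(λ, y)‖, then ‖(x, y)‖ ≤ (√2·L/√(1 − L²))·‖λ‖. (This is the estimate showing that the invariant section χ : Λ → B̄_u(R) × B̄_s(R), whose graph is the maximal invariant set Λ*, is Lipschitz with constant √2·L/√(1 − L²), and that the point of Λ* over each base point is unique.) -/
noncomputable section

open Metric Set

/-- Lemma 6.3 (Lipschitz estimate for the invariant section `χ`): if the
difference vector `(λ, x, y)` of two points lies simultaneously in the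
center-unstable cone `‖y‖ ≤ L‖(λ,x)‖` and the center-stable cone
`‖x‖ ≤ L‖(λ,y)‖` of slope `L < 1` (Euclidean product norms), then
`‖(x,y)‖ ≤ (√2·L/√(1−L²))·‖λ‖`. -/
theorem stmt19 (c u s : ℕ) (hc : 0 < c) (hu : 0 < u) (hs : 0 < s)
    (L : ℝ) (hL0 : 0 < L) (hL1 : L < 1)
    (lam : Evec c) (x : Evec u) (y : Evec s)
    (hcu : ‖y‖ ≤ L * Real.sqrt (‖lam‖ ^ 2 + ‖x‖ ^ 2))
    (hcs : ‖x‖ ≤ L * Real.sqrt (‖lam‖ ^ 2 + ‖y‖ ^ 2)) :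
    Real.sqrt (‖x‖ ^ 2 + ‖y‖ ^ 2)
      ≤ Real.sqrt 2 * L / Real.sqrt (1 - L ^ 2) * ‖lam‖ := by
  have hp : 0 < 1 - L ^ 2 := by nlinarith
  have h1 : ‖y‖ ^ 2 ≤ L ^ 2 * (‖lam‖ ^ 2 + ‖x‖ ^ 2) := by
    have h := pow_le_pow_left₀ (norm_nonneg y) hcu 2
    rwa [mul_pow, Real.sq_sqrt (by positivity)] at h
  have h2 : ‖x‖ ^ 2 ≤ L ^ 2 * (‖lam‖ ^ 2 + ‖y‖ ^ 2) := by
    have h := pow_le_pow_left₀ (norm_nonneg x) hcs 2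
    rwa [mul_pow, Real.sq_sqrt (by positivity)] at h
  apply Real.sqrt_le_iff.mpr
  refine ⟨by positivity, ?_⟩
  rw [mul_pow, div_pow, mul_pow, Real.sq_sqrt (by norm_num), Real.sq_sqrt hp.le,
    div_mul_eq_mul_div, le_div_iff₀ hp]
  nlinarith
end
end
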